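/- Let S be a finite nonabelian simple group. Then there do not exist nilpotent subgroups A and B of S such that every element of S is a product ab with a ∈ A and b ∈ B. In other words, a finite nonabelian simple group admits no factorization S = AB with both factors nilpotent. -/

import Mathlib

section

variable {G : Type*} [Group G]

/-- An element is a `π`-element if all primes dividing its order lie in `π`. -/
def IsPrimesElt (π : Set ℕ) (x : G) : Prop := ∀ q : ℕ, q.Prime → q ∣ orderOf x → q ∈ π

/-- The subgroup generated by the `π`-elements of `A`. -/
def primesPart (π : Set ℕ) (A : Subgroup G) : Subgroup G :=
  Subgroup.closure {x | x ∈ A ∧ IsPrimesElt π x}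

theorem isPrimesElt_map {H : Type*} [Group H] {π : Set ℕ} (f : G →* H) {x : G}
    (h : IsPrimesElt π x) : IsPrimesElt π (f x) :=
  fun q hq hd => h q hq (hd.trans (orderOf_map_dvd f x))

theorem isPrimesElt_map_iff {H : Type*} [Group H] {π : Set ℕ} {f : G →* H}
    (hf : Function.Injective f) {x : G} : IsPrimesElt π (f x) ↔ IsPrimesElt π x := by
  simp [IsPrimesElt, orderOf_injective f hf]

theorem isPrimesElt_conj {π : Set ℕ} {x : G} (g : G) (h : IsPrimesElt π x) :
    IsPrimesElt π (g * x * g⁻¹) := by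
  simpa using isPrimesElt_map (MulAut.conj g).toMonoidHom h

theorem isPrimesElt_mono {π σ : Set ℕ} (hs : π ⊆ σ) {x : G} (h : IsPrimesElt π x) :
    IsPrimesElt σ x := fun q hq hd => hs (h q hq hd)

theorem isPrimesElt_one {π : Set ℕ} : IsPrimesElt π (1 : G) := by
  intro q hq hd
  simp at hd
  exact absurd hd hq.ne_one

theorem isPrimesElt_inv {π : Set ℕ} {x : G} (h : IsPrimesElt π x) : IsPrimesElt π x⁻¹ := by
  simpa [IsPrimesElt] using h

theorem isPrimesElt_singleton_iff [Finite G] {p : ℕ} (hp : p.Prime) {x : G} :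
    IsPrimesElt {p} x ↔ ∃ k, x ^ p ^ k = 1 := by
  constructor
  · intro h
    refine ⟨(orderOf x).primeFactorsList.length, ?_⟩
    rw [← orderOf_dvd_iff_pow_eq_one]
    apply dvd_of_eq
    exact Nat.eq_prime_pow_of_unique_prime_dvd (orderOf_pos x).ne' (fun hq hd => h _ hq hd)
  · rintro ⟨k, hk⟩ q hq hd
    have := hd.trans (orderOf_dvd_of_pow_eq_one hk)
    exact (Nat.prime_dvd_prime_iff_eq hq hp).1 (hq.dvd_of_dvd_pow this)

theorem eq_one_of_isPrimesElt [Finite G] {π σ : Set ℕ} (hd : Disjoint π σ) {x : G}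
    (h : IsPrimesElt π x) (h' : IsPrimesElt σ x) : x = 1 := by
  by_contra hx
  have : orderOf x ≠ 1 := by simpa using hx
  obtain ⟨q, hq, hqx⟩ := Nat.exists_prime_and_dvd this
  exact Set.disjoint_left.1 hd (h q hq hqx) (h' q hq hqx)

theorem primesPart_le (π : Set ℕ) (A : Subgroup G) : primesPart π A ≤ A := by
  rw [primesPart, Subgroup.closure_le]
  exact fun x hx => hx.1

theorem mem_primesPart_of {π : Set ℕ} {A : Subgroup G} {x : G} (hx : x ∈ A)
    (h : IsPrimesElt π x) : x ∈ primesPart π A := Subgroup.subset_closure ⟨hx, h⟩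

theorem primesPart_mono {π σ : Set ℕ} (hs : π ⊆ σ) (A : Subgroup G) :
    primesPart π A ≤ primesPart σ A :=
  Subgroup.closure_mono fun _ hx => ⟨hx.1, isPrimesElt_mono hs hx.2⟩

/-- In a product of `p`-groups, `π`-elements are those supported on `π`. -/
theorem isPrimesElt_pi_iff {s : Finset ℕ} (hs : ∀ p ∈ s, p.Prime) {P : s → Type*} [∀ p, Group (P p)]
    [∀ p, Finite (P p)] (hP : ∀ p : s, IsPGroup p (P p)) {π : Set ℕ} (x : ∀ p, P p) :
    IsPrimesElt π x ↔ ∀ p : s, (p : ℕ) ∉ π → x p = 1 := by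
  constructor
  · intro h p hp
    have h1 : IsPrimesElt π (x p) := isPrimesElt_map (Pi.evalMonoidHom P p) h
    have h2 : IsPrimesElt {(p : ℕ)} (x p) :=
      (isPrimesElt_singleton_iff (hs p p.2)).2 (hP p (x p))
    exact eq_one_of_isPrimesElt (by simpa using hp) h1 h2
  · intro h q hq hd
    by_contra hqπ
    rw [Pi.orderOf] at hd
    have : ∃ p : s, q ∣ orderOf (x p) := by
      by_contra! hc
      have : ∀ t : Finset s, ¬ q ∣ t.lcm (fun i => orderOf (x i)) := by
        intro t
        induction t using Finset.induction_on with
        | empty => simpa using hq.ne_one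
        | insert a t _ ih =>
          rw [Finset.lcm_insert]
          intro hh
          have := hh.trans (Nat.lcm_dvd_mul _ _)
          rcases hq.dvd_mul.1 this with h | h
          · exact hc _ h
          · exact ih h
      exact this _ hd
    obtain ⟨p, hp⟩ := this
    obtain ⟨k, hk⟩ := hP p (x p)
    have := hq.dvd_of_dvd_pow (hp.trans (orderOf_dvd_of_pow_eq_one hk))
    rw [Nat.prime_dvd_prime_iff_eq hq (hs p p.2)] at this
    subst this
    rw [h p hqπ] at hp
    simp at hp
    exact hq.ne_one hp

theorem exists_pi_equiv.{u} {G : Type u} [Group G] [Finite G] [Group.IsNilpotent G] :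
    ∃ (s : Finset ℕ) (P : s → Type u) (_ : ∀ p, Group (P p)) (_ : ∀ p, Finite (P p)),
      (∀ p ∈ s, p.Prime) ∧ (∀ p : s, IsPGroup p (P p)) ∧ Nonempty (G ≃* ∀ p, P p) := by
  classical
  obtain ⟨e⟩ := ((Group.isNilpotent_of_finite_tfae (G := G)).out 0 4).1 ‹_›
  let P : (Nat.card G).primeFactors → Type u := fun p => ∀ Q : Sylow (p : ℕ) G, (Q : Subgroup G)
  refine ⟨(Nat.card G).primeFactors, P, fun p => Pi.group, fun p => Pi.finite,
    fun p hp => Nat.prime_of_mem_primeFactors hp, ?_, ⟨e.symm⟩⟩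
  intro p x
  have : Fact (p : ℕ).Prime := ⟨Nat.prime_of_mem_primeFactors p.2⟩
  choose k hk using fun P : Sylow p G => P.2 (x P)
  have := Fintype.ofFinite (Sylow p G)
  refine ⟨∑ P, k P, ?_⟩
  funext P
  rw [Pi.pow_apply, ← Finset.sum_erase_add _ _ (Finset.mem_univ P), pow_add, mul_comm, pow_mul, hk,
    one_pow]
  rfl

theorem IsPrimesElt.mul_of_nilpotent [Finite G] [Group.IsNilpotent G] {π : Set ℕ} {x y : G}
    (hx : IsPrimesElt π x) (hy : IsPrimesElt π y) : IsPrimesElt π (x * y) := by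
  obtain ⟨s, P, _, _, hs, hP, ⟨e⟩⟩ := exists_pi_equiv (G := G)
  rw [← isPrimesElt_map_iff (f := e.toMonoidHom) e.injective] at *
  erw [isPrimesElt_pi_iff hs hP] at *
  intro p hp
  have h1 := hx p hp
  have h2 := hy p hp
  simp_all

theorem IsPrimesElt.commute_of_nilpotent [Finite G] [Group.IsNilpotent G] {π σ : Set ℕ}
    (hd : Disjoint π σ) {x y : G}
    (hx : IsPrimesElt π x) (hy : IsPrimesElt σ y) : x * y = y * x := by
  obtain ⟨s, P, _, _, hs, hP, ⟨e⟩⟩ := exists_pi_equiv (G := G)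
  rw [← isPrimesElt_map_iff (f := e.toMonoidHom) e.injective] at *
  erw [isPrimesElt_pi_iff hs hP] at *
  apply e.injective
  funext p
  simp only [map_mul, Pi.mul_apply]
  by_cases hp : (p : ℕ) ∈ π
  · have := hy p (Set.disjoint_left.1 hd hp)
    simp_all
  · have := hx p hp
    simp_all

theorem exists_mul_of_nilpotent [Finite G] [Group.IsNilpotent G] (π : Set ℕ) (x : G) :
    ∃ y z, IsPrimesElt π y ∧ IsPrimesElt πᶜ z ∧ x = y * z := by
  classical
  obtain ⟨s, P, _, _, hs, hP, ⟨e⟩⟩ := exists_pi_equiv (G := G)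
  refine ⟨e.symm fun p => if (p : ℕ) ∈ π then e x p else 1,
    e.symm fun p => if (p : ℕ) ∈ π then 1 else e x p, ?_, ?_, ?_⟩
  · rw [← isPrimesElt_map_iff (f := e.toMonoidHom) e.injective]
    erw [isPrimesElt_pi_iff hs hP]
    intro p hp
    simp [hp]
  · rw [← isPrimesElt_map_iff (f := e.toMonoidHom) e.injective]
    erw [isPrimesElt_pi_iff hs hP]
    intro p hp
    have : (p : ℕ) ∈ π := by simpa using hp
    simp [this]
  · apply e.injective
    funext p
    simp
    split_ifs <;> simp

variable {A : Subgroup G} {π σ : Set ℕ}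

theorem isPrimesElt_coe {x : A} : IsPrimesElt π (x : G) ↔ IsPrimesElt π x :=
  isPrimesElt_map_iff (f := A.subtype) A.subtype_injective

theorem mem_primesPart_iff [Finite G] [Group.IsNilpotent A] {x : G} : x ∈ primesPart π A ↔ x ∈ A ∧
    IsPrimesElt π x := by
  refine ⟨fun h => ?_, fun h => mem_primesPart_of h.1 h.2⟩
  induction h using Subgroup.closure_induction with
  | mem x hx => exact hx
  | one => exact ⟨one_mem _, isPrimesElt_one⟩
  | inv x _ hx => exact ⟨inv_mem hx.1, isPrimesElt_inv hx.2⟩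
  | mul x y _ _ hx hy =>
    refine ⟨mul_mem hx.1 hy.1, ?_⟩
    lift x to A using hx.1
    lift y to A using hy.1
    rw [← Subgroup.coe_mul, isPrimesElt_coe]
    exact (isPrimesElt_coe.1 hx.2).mul_of_nilpotent (isPrimesElt_coe.1 hy.2)

theorem conj_mem_primesPart [Finite G] [Group.IsNilpotent A] {g x : G} (hg : ∀ a ∈ A,
    g * a * g⁻¹ ∈ A) (hx : x ∈ primesPart π A) :
    g * x * g⁻¹ ∈ primesPart π A := by
  rw [mem_primesPart_iff] at *
  exact ⟨hg _ hx.1, isPrimesElt_conj g hx.2⟩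

theorem commute_of_mem_primesPart [Finite G] [Group.IsNilpotent A] (hd : Disjoint π σ) {x y : G}
    (hx : x ∈ primesPart π A)
    (hy : y ∈ primesPart σ A) : x * y = y * x := by
  rw [mem_primesPart_iff] at hx hy
  have := IsPrimesElt.commute_of_nilpotent hd (x := (⟨x, hx.1⟩ : A)) (y := ⟨y, hy.1⟩)
    (isPrimesElt_coe.1 hx.2) (isPrimesElt_coe.1 hy.2)
  exact congrArg Subtype.val this

theorem exists_mul_of_mem [Finite G] [Group.IsNilpotent A] {x : G} (π : Set ℕ) (hx : x ∈ A) :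
    ∃ y ∈ primesPart π A, ∃ z ∈ primesPart πᶜ A, x = y * z := by
  obtain ⟨y, z, hy, hz, h⟩ := exists_mul_of_nilpotent π (⟨x, hx⟩ : A)
  exact ⟨y, mem_primesPart_of y.2 (isPrimesElt_coe.2 hy), z,
    mem_primesPart_of z.2 (isPrimesElt_coe.2 hz), congrArg Subtype.val h⟩

theorem prime_mem_of_dvd_card_primesPart [Finite G] [Group.IsNilpotent A] {q : ℕ} (hq : q.Prime)
    (h : q ∣ Nat.card (primesPart π A)) :
    q ∈ π := by
  have := Fact.mk hq
  obtain ⟨x, hx⟩ := exists_prime_orderOf_dvd_card' q h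
  have h1 := (mem_primesPart_iff.1 x.2).2 q hq
  rw [Subgroup.orderOf_coe, hx] at h1
  exact h1 dvd_rfl

theorem card_primesPart_mul [Finite G] [Group.IsNilpotent A] (π : Set ℕ) :
    Nat.card (primesPart π A) * Nat.card (primesPart πᶜ A) = Nat.card A := by
  rw [← Nat.card_prod]
  refine Nat.card_congr (Equiv.ofBijective (fun x => (⟨x.1 * x.2,
    mul_mem (primesPart_le _ _ x.1.2) (primesPart_le _ _ x.2.2)⟩ : A)) ⟨?_, ?_⟩)
  · rintro ⟨⟨a, ha⟩, ⟨b, hb⟩⟩ ⟨⟨c, hc⟩, ⟨d, hd⟩⟩ h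
    have h : a * b = c * d := congrArg Subtype.val h
    have h2 : c⁻¹ * a = d * b⁻¹ := by
      rw [inv_mul_eq_iff_eq_mul, ← mul_assoc, ← h]; group
    have h3 := mem_primesPart_iff.1 (mul_mem (inv_mem hc) ha)
    have h4 := mem_primesPart_iff.1 (mul_mem hd (inv_mem hb))
    rw [← h2] at h4
    have h5 := eq_one_of_isPrimesElt disjoint_compl_right h3.2 h4.2
    have h6 : c = a := by rwa [inv_mul_eq_one] at h5
    rw [h5] at h2
    have h7 : d = b := by rwa [eq_comm, mul_inv_eq_one] at h2
    simp [h6, h7]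
  · rintro ⟨x, hx⟩
    obtain ⟨y, hy, z, hz, h⟩ := exists_mul_of_mem π hx
    exact ⟨⟨⟨y, hy⟩, ⟨z, hz⟩⟩, Subtype.ext h.symm⟩

theorem isPGroup_primesPart [Finite G] [Group.IsNilpotent A] {p : ℕ} (hp : p.Prime) :
    IsPGroup p (primesPart {p} A) := by
  intro x
  obtain ⟨k, hk⟩ := (isPrimesElt_singleton_iff hp).1 (mem_primesPart_iff.1 x.2).2
  exact ⟨k, Subtype.ext (by simpa using hk)⟩

theorem primesPart_singleton_ne_bot [Finite G] {p : ℕ} (hp : p.Prime) (h : p ∣ Nat.card A) :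
    primesPart {p} A ≠ ⊥ := by
  have := Fact.mk hp
  obtain ⟨x, hx⟩ := exists_prime_orderOf_dvd_card' p h
  intro hb
  have : (x : G) ∈ primesPart {p} A := by
    refine mem_primesPart_of x.2 ?_
    intro q hq hd
    rw [Subgroup.orderOf_coe, hx] at hd
    exact (Nat.prime_dvd_prime_iff_eq hq hp).1 hd
  rw [hb, Subgroup.mem_bot] at this
  have h1 : x = 1 := Subtype.ext this
  rw [h1] at hx
  simp at hx
  exact hp.ne_one hx.symm

theorem dvd_card_of_primesPart_ne_bot [Finite G] {p : ℕ} (hp : p.Prime) (h : primesPart {p} A ≠ ⊥) :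
    p ∣ Nat.card A := by
  by_contra hc
  apply h
  rw [primesPart, Subgroup.closure_eq_bot_iff]
  rintro x ⟨hx, hx2⟩
  refine eq_one_of_isPrimesElt (σ := {p}ᶜ) disjoint_compl_right hx2 ?_
  intro q hq hd hqp
  simp only [Set.mem_singleton_iff] at hqp
  subst hqp
  exact hc (hd.trans (Subgroup.orderOf_dvd_natCard A hx))

theorem exists_prime_dvd_of_ne_bot [Finite G] (h : A ≠ ⊥) : ∃ p, p.Prime ∧ p ∣ Nat.card A := by
  have : Nat.card A ≠ 1 := by rwa [Ne, Subgroup.card_eq_one]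
  exact Nat.exists_prime_and_dvd this

theorem isNilpotent_of_le [Group.IsNilpotent A] {H : Subgroup G} (h : H ≤ A) : Group.IsNilpotent
    H :=
  Subgroup.isNilpotent_of_ker_le_center (Subgroup.inclusion h) (by
    rw [(MonoidHom.ker_eq_bot_iff _).2 (Subgroup.inclusion_injective h)]; exact bot_le)

theorem isNilpotent_primesPart [Group.IsNilpotent A] : Group.IsNilpotent (primesPart π A) :=
  isNilpotent_of_le (primesPart_le π A)

/-- A nontrivial `p`-part contains a nontrivial central element. -/
theorem exists_central_of_primesPart_ne_bot [Finite G] [Group.IsNilpotent A]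
    (h : primesPart π A ≠ ⊥) :
    ∃ z ∈ primesPart π A, z ≠ 1 ∧ ∀ a ∈ A, a * z = z * a := by
  have hnil : Group.IsNilpotent (primesPart π A) := isNilpotent_primesPart
  have : Nontrivial (primesPart π A) := (Subgroup.nontrivial_iff_ne_bot _).2 h
  have hc := Group.IsNilpotent.center_ne_bot (G := primesPart π A)
  obtain ⟨⟨z, hz⟩, hz1⟩ := Subgroup.ne_bot_iff_exists_ne_one.1 hc
  refine ⟨z, z.2, ?_, ?_⟩
  · intro h; exact hz1 (Subtype.ext (Subtype.ext h))
  · intro a ha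
    obtain ⟨y, hy, w, hw, rfl⟩ := exists_mul_of_mem π ha
    have h1 : y * z = z * y := congrArg Subtype.val (Subgroup.mem_center_iff.1 hz ⟨y, hy⟩)
    have h2 := commute_of_mem_primesPart (disjoint_compl_right) z.2 hw
    rw [mul_assoc, ← h2, ← mul_assoc, h1, mul_assoc]

end

section

open Subgroup
variable {G : Type*} [Group G]

theorem le_normalizer_of_conj [Finite G] {H K : Subgroup G} (h : ∀ x ∈ H, ∀ k ∈ K,
    x * k * x⁻¹ ∈ K) :
    H ≤ normalizer (K : Set G) := by
  intro x hx
  rw [mem_normalizer_iff]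
  refine fun k => ⟨fun hk => h x hx k hk, fun hk => ?_⟩
  have := h x⁻¹ (inv_mem hx) _ hk
  simpa [mul_assoc] using this

theorem conj_mem_of_le_normalizer {H K : Subgroup G} (h : H ≤ normalizer (K : Set G)) {x k : G}
    (hx : x ∈ H) (hk : k ∈ K) : x * k * x⁻¹ ∈ K :=
  (mem_normalizer_iff.1 (h hx) k).1 hk

theorem normalizer_le_normalizer_centralizer [Finite G] (K : Subgroup G) :
    normalizer (K : Set G) ≤ normalizer (centralizer (K : Set G) : Set G) := by
  refine le_normalizer_of_conj fun x hx c hc => ?_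
  rw [mem_centralizer_iff] at hc ⊢
  intro k hk
  have h1 := hc (x⁻¹ * k * x) ((mem_normalizer_iff''.1 hx k).1 hk)
  calc k * (x * c * x⁻¹) = x * (x⁻¹ * k * x * c) * x⁻¹ := by group
    _ = _ := by rw [h1]; group

theorem normalizer_le_normalizer_primesPart [Finite G] (π : Set ℕ) (A : Subgroup G) :
    normalizer (A : Set G) ≤ normalizer (primesPart π A : Set G) := by
  refine le_normalizer_of_conj fun x hx c hc => ?_
  have : primesPart π A ≤ (primesPart π A).comap (MulAut.conj x).toMonoidHom := by
    conv_lhs => rw [primesPart]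
    rw [closure_le]
    rintro y ⟨hy, hy2⟩
    exact mem_primesPart_of ((mem_normalizer_iff.1 hx y).1 hy) (isPrimesElt_conj x hy2)
  exact this hc

theorem le_normalizer_inf {H K L : Subgroup G} (h1 : H ≤ normalizer (K : Set G))
    (h2 : H ≤ normalizer (L : Set G)) : H ≤ normalizer ((K ⊓ L : Subgroup G) : Set G) := by
  intro x hx
  rw [mem_normalizer_iff]
  intro y
  exact and_congr (mem_normalizer_iff.1 (h1 hx) y) (mem_normalizer_iff.1 (h2 hx) y)

theorem le_of_primesPart_le [Finite G] {A T : Subgroup G} [Group.IsNilpotent A]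
    (h : ∀ p : ℕ, p.Prime → primesPart {p} A ≤ T) : A ≤ T := by
  have key : ∀ s : Finset ℕ, (∀ p ∈ s, p.Prime) → primesPart s A ≤ T := by
    intro s
    induction s using Finset.induction_on with
    | empty =>
      intro _ y hy
      have := (mem_primesPart_iff.1 hy).2
      rw [eq_one_of_isPrimesElt (by simp) this this]
      exact one_mem _
    | insert p s _ ih =>
      intro hs y hy
      obtain ⟨u, hu, v, hv, rfl⟩ := exists_mul_of_mem {p} ((primesPart_le _ _) hy)
      refine mul_mem (h p (hs p (by simp)) hu) (ih (fun q hq => hs q (by simp [hq])) ?_)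
      have h1 : v ∈ primesPart (↑(insert p s)) A := by
        have := mul_mem (inv_mem (primesPart_mono (σ := ↑(insert p s)) (by simp) A hu)) hy
        simpa using this
      rw [mem_primesPart_iff] at h1 hv ⊢
      refine ⟨hv.1, fun q hq hd => ?_⟩
      have h2 := h1.2 q hq hd
      have h3 := hv.2 q hq hd
      simp at h2 h3
      simpa [h3] using h2
  intro y hy
  refine key (Nat.card A).primeFactors (fun p hp => Nat.prime_of_mem_primeFactors hp)
    (mem_primesPart_of hy ?_)
  intro q hq hd
  simp only [Finset.mem_coe, Nat.mem_primeFactors]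
  exact ⟨hq, hd.trans (orderOf_dvd_natCard A hy), Nat.card_pos.ne'⟩

theorem isNilpotent_of_commutator_commute {D : Subgroup G}
    (h : ∀ x ∈ ⁅D, D⁆, ∀ y ∈ D, x * y = y * x) : Group.IsNilpotent D := by
  refine Subgroup.isNilpotent_of_ker_le_center (Abelianization.of (G := D)) ?_
  rw [Abelianization.ker_of]
  intro x hx
  rw [mem_center_iff]
  intro y
  refine Subtype.ext (h x ?_ y y.2).symm
  rw [← map_subtype_commutator]
  exact mem_map_of_mem _ hx

theorem exists_commutative_normal_of_commute [Finite G] {H : Subgroup G} (hH : Group.IsSolvable H)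
    {x : G} (hx : x ∈ H)
    (hc : ∀ K ≤ H, H ≤ normalizer (K : Set G) → ∀ p : ℕ, p.Prime → IsPGroup p K →
      ∀ k ∈ K, x * k = k * x) :
    ∃ C ≤ H, H ≤ normalizer (C : Set G) ∧ (∀ a ∈ C, ∀ b ∈ C, a * b = b * a) ∧ x ∈ C := by
  set 𝒩 : Set (Subgroup G) := {D | D ≤ H ∧ H ≤ normalizer (D : Set G) ∧ Group.IsNilpotent D} with h𝒩
  set F := sSup 𝒩 with hF
  have hFn : H ≤ normalizer (F : Set G) := by
    refine le_normalizer_of_conj fun h hh k hk => ?_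
    have : F ≤ F.comap (MulAut.conj h).toMonoidHom := by
      refine sSup_le fun D hD y hy => ?_
      exact le_sSup (a := D) hD (conj_mem_of_le_normalizer hD.2.1 hh hy)
    exact this hk
  have hxF : F ≤ centralizer {x} := by
    refine sSup_le fun D hD => ?_
    have := hD.2.2
    refine le_of_primesPart_le fun p hp y hy => ?_
    rw [mem_centralizer_singleton_iff]
    exact (hc _ ((primesPart_le _ _).trans hD.1)
      (hD.2.1.trans (normalizer_le_normalizer_primesPart _ _)) p hp (isPGroup_primesPart hp) y
        hy).symm
  set C := H ⊓ centralizer (F : Set G) with hC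
  have hCn : H ≤ normalizer (C : Set G) :=
    le_normalizer_inf le_normalizer (hFn.trans (normalizer_le_normalizer_centralizer F))
  have hCF : C ≤ F := by
    by_contra hcon
    obtain ⟨D, hD⟩ := Set.Finite.exists_minimal
      (s := {D : Subgroup G | D ≤ C ∧ H ≤ normalizer (D : Set G) ∧ ¬ D ≤ F})
      (Set.toFinite _) ⟨C, le_rfl, hCn, hcon⟩
    obtain ⟨⟨hDC, hDn, hDF⟩, hmin⟩ := hD
    have hDH : D ≤ H := hDC.trans inf_le_left
    have hle : ⁅D, D⁆ ≤ D := commutator_le_self D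
    have hlt : ¬ D ≤ ⁅D, D⁆ := by
      intro hh
      have : Nontrivial D := by
        rw [nontrivial_iff_ne_bot]; rintro rfl; exact hDF bot_le
      have : Group.IsSolvable D := Group.isSolvable_of_isSolvable_injective
        (inclusion_injective hDH)
      have h1 := Group.IsSolvable.commutator_lt_top_of_nontrivial D
      apply h1.ne
      rw [eq_top_iff]
      intro y _
      have := hh y.2
      rw [← map_subtype_commutator] at this
      obtain ⟨z, hz, hzy⟩ := this
      rwa [← Subtype.ext hzy]
    have hcF : ⁅D, D⁆ ≤ F := by
      by_contra hcF
      refine hlt (hmin ⟨hle.trans hDC, ?_, hcF⟩ hle)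
      refine le_normalizer_of_conj fun h hh k hk => ?_
      have h2 : ⁅D, D⁆ ≤ ⁅D, D⁆.comap (MulAut.conj h).toMonoidHom := by
        rw [commutator_le]
        intro a ha b hb
        rw [mem_comap, map_commutatorElement]
        exact commutator_mem_commutator (conj_mem_of_le_normalizer hDn hh ha)
          (conj_mem_of_le_normalizer hDn hh hb)
      exact h2 hk
    have hnil : Group.IsNilpotent D := isNilpotent_of_commutator_commute fun u hu y hy =>
      mem_centralizer_iff.1 (hDC hy).2 u (hcF hu)
    exact hDF (le_sSup ⟨hDH, hDn, hnil⟩)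
  refine ⟨C, inf_le_left, hCn, fun a ha b hb => (mem_centralizer_iff.1 hb.2 a (hCF ha)), hx, ?_⟩
  refine mem_centralizer_iff.2 ?_
  exact fun y hy => mem_centralizer_singleton_iff.1 (hxF hy)

end

section

open Subgroup
variable {G : Type*} [Group G]

theorem exists_conj_le_of_isPGroup [Finite G] {p : ℕ} (hp : p.Prime) {L P Q : Subgroup G}
    (hP : P ≤ L)
    (hQ : Q ≤ L) (hPp : IsPGroup p P) (hQp : IsPGroup p Q) {m : ℕ}
    (hm : Nat.card L = Nat.card Q * m) (hpm : ¬ p ∣ m) :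
    ∃ l ∈ L, ∀ x ∈ P, l * x * l⁻¹ ∈ Q := by
  have := Fact.mk hp
  have hQp' : IsPGroup p (Q.subgroupOf L) := hQp.of_equiv (subgroupOfEquivOfLe hQ).symm
  have hPp' : IsPGroup p (P.subgroupOf L) := hPp.of_equiv (subgroupOfEquivOfLe hP).symm
  have hidx : ¬ p ∣ (Q.subgroupOf L).index := by
    have h1 := card_mul_index (Q.subgroupOf L)
    rw [Nat.card_congr (subgroupOfEquivOfLe hQ).toEquiv, hm] at h1
    rwa [Nat.eq_of_mul_eq_mul_left Nat.card_pos h1]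
  obtain ⟨S, hS⟩ := hPp'.exists_le_sylow
  obtain ⟨l, hl⟩ := MulAction.exists_smul_eq L S (hQp'.toSylow hidx)
  refine ⟨l, l.2, fun x hx => ?_⟩
  have h1 : (⟨x, hP hx⟩ : L) ∈ S := hS hx
  have h2 : l * ⟨x, hP hx⟩ * l⁻¹ ∈ (l • S) := by
    rw [← MulAut.conj_apply]
    exact Subgroup.smul_mem_pointwise_smul _ _ _ h1
  rw [hl] at h2
  exact h2

theorem isNilpotent_map_conj {A : Subgroup G} (hA : Group.IsNilpotent A) (g : G) :
    Group.IsNilpotent (A.map (MulAut.conj g).toMonoidHom) :=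
  Group.nilpotent_of_mulEquiv (A.equivMapOfInjective _ (MulAut.conj g).injective)

theorem card_map_conj (A : Subgroup G) (g : G) :
    Nat.card (A.map (MulAut.conj g).toMonoidHom) = Nat.card A :=
  card_map_of_injective (MulAut.conj g).injective

theorem mem_map_conj {A : Subgroup G} {g x : G} :
    x ∈ A.map (MulAut.conj g).toMonoidHom ↔ g⁻¹ * x * g ∈ A := by
  constructor
  · rintro ⟨y, hy, rfl⟩
    simpa [mul_assoc] using hy
  · intro h
    exact ⟨_, h, by simp [mul_assoc]⟩

theorem card_isPGroup_coprime [Finite G] {p q : ℕ} (hp : p.Prime) (hq : q.Prime) {P : Subgroup G}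
    (hP : IsPGroup p P)
    (h : q ∣ Nat.card P) : q = p := by
  have := Fact.mk hp
  obtain ⟨k, hk⟩ := hP.exists_card_eq
  rw [hk] at h
  exact (Nat.prime_dvd_prime_iff_eq hq hp).1 (hq.dvd_of_dvd_pow h)

theorem not_dvd_card_primesPart_compl [Finite G] {p : ℕ} (hp : p.Prime) (R : Subgroup G)
    [Group.IsNilpotent R] :
    ¬ p ∣ Nat.card (primesPart {p}ᶜ R) := fun h => by
  simpa using prime_mem_of_dvd_card_primesPart hp h

theorem card_primesPart_singleton [Finite G] {p : ℕ} (hp : p.Prime) (R : Subgroup G)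
    [Group.IsNilpotent R] :
    Nat.card (primesPart {p} R) = p ^ (Nat.card R).factorization p := by
  have := Fact.mk hp
  obtain ⟨k, hk⟩ := (isPGroup_primesPart (A := R) hp).exists_card_eq
  rw [← card_primesPart_mul (A := R) {p}, hk, Nat.factorization_mul (by simp [hp.ne_zero])
    Nat.card_pos.ne',
    hp.factorization_pow]
  simp [Nat.factorization_eq_zero_of_not_dvd (not_dvd_card_primesPart_compl hp R)]

/-- **Wielandt**: nilpotent Hall subgroups of the same order are conjugate. -/
theorem exists_conj_of_isNilpotent_hall [Finite G] {L R₁ R₂ : Subgroup G} (h1 : R₁ ≤ L)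
    (h2 : R₂ ≤ L)
    (hn1 : Group.IsNilpotent R₁) (hn2 : Group.IsNilpotent R₂) (hc : Nat.card R₁ = Nat.card R₂)
    {m : ℕ}
    (hm : Nat.card L = Nat.card R₂ * m) (hcop : (Nat.card R₂).Coprime m) :
    ∃ l ∈ L, ∀ x ∈ R₁, l * x * l⁻¹ ∈ R₂ := by
  induction hn : Nat.card R₂ using Nat.strong_induction_on generalizing L R₁ R₂ m with
  | _ n ih =>
  by_cases hbot : R₂ = ⊥
  · have : R₁ = ⊥ := by
      rw [← card_eq_one, hc, hbot, card_bot]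
    subst this
    exact ⟨1, one_mem _, by simp⟩
  obtain ⟨p, hp, hpd⟩ := exists_prime_dvd_of_ne_bot hbot
  set P₂ := primesPart {p} R₂
  set Q₂ := primesPart {p}ᶜ R₂
  have hP2R : P₂ ≤ R₂ := primesPart_le _ _
  have hQ2R : Q₂ ≤ R₂ := primesPart_le _ _
  have hmul : Nat.card P₂ * Nat.card Q₂ = Nat.card R₂ := card_primesPart_mul {p}
  have hpQ : ¬ p ∣ Nat.card Q₂ := not_dvd_card_primesPart_compl hp R₂
  have hpm : ¬ p ∣ m := fun h => hp.ne_one (Nat.eq_one_of_dvd_coprimes hcop hpd h)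
  obtain ⟨l, hl, hlP⟩ := exists_conj_le_of_isPGroup hp ((primesPart_le {p} R₁).trans h1)
    (hP2R.trans h2)
    (isPGroup_primesPart hp) (isPGroup_primesPart hp) (m := Nat.card Q₂ * m)
    (by rw [hm, ← hmul, mul_assoc]) (fun h => by
      rcases hp.dvd_mul.1 h with h | h
      exacts [hpQ h, hpm h])
  set R := R₁.map (MulAut.conj l).toMonoidHom with hR
  have hRn : Group.IsNilpotent R := isNilpotent_map_conj hn1 l
  have hRc : Nat.card R = Nat.card R₂ := (card_map_conj _ _).trans hc
  have hRL : R ≤ L := by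
    rintro _ ⟨y, hy, rfl⟩
    exact mul_mem (mul_mem hl (h1 hy)) (inv_mem hl)
  have hPle : primesPart {p} R ≤ P₂ := by
    intro x hx
    rw [mem_primesPart_iff, mem_map_conj] at hx
    have h3 := hlP _ (mem_primesPart_of hx.1 (by simpa using isPrimesElt_conj l⁻¹ hx.2))
    simpa [mul_assoc] using h3
  have hPcard : Nat.card (primesPart {p} R) = Nat.card P₂ := by
    rw [card_primesPart_singleton hp, hRc, ← card_primesPart_singleton hp]
  have hPeq : primesPart {p} R = P₂ := eq_of_le_of_card_ge hPle hPcard.ge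
  have hQcard : Nat.card (primesPart {p}ᶜ R) = Nat.card Q₂ := by
    have := card_primesPart_mul (A := R) {p}
    rw [hPcard, hRc, ← hmul] at this
    exact Nat.eq_of_mul_eq_mul_left Nat.card_pos this
  set L' := L ⊓ centralizer (P₂ : Set G)
  have hQL : Q₂ ≤ L' := le_inf (hQ2R.trans h2) fun x hx => mem_centralizer_iff.2 fun y hy =>
    commute_of_mem_primesPart disjoint_compl_right hy hx
  have hQL' : primesPart {p}ᶜ R ≤ L' := le_inf ((primesPart_le _ _).trans hRL) fun x hx =>
    mem_centralizer_iff.2 fun y hy => by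
      rw [SetLike.mem_coe, ← hPeq] at hy
      exact commute_of_mem_primesPart disjoint_compl_right hy hx
  obtain ⟨m', hm'⟩ := card_dvd_of_le hQL
  have hlt : Nat.card Q₂ < n := by
    rw [← hn, ← hmul]
    have h3 : 1 < Nat.card P₂ := by
      rw [one_lt_card_iff_ne_bot]
      exact primesPart_singleton_ne_bot hp hpd
    nlinarith [Nat.card_pos (α := Q₂)]
  obtain ⟨l', hl', hlQ⟩ := ih _ hlt hQL' hQL isNilpotent_primesPart isNilpotent_primesPart hQcard
    hm' (by
      refine Nat.Coprime.symm (Nat.coprime_of_dvd ?_)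
      intro q hq hqm hqQ
      have h4 : Nat.card Q₂ * q ∣ Nat.card Q₂ * (Nat.card P₂ * m) := by
        have : Nat.card Q₂ * (Nat.card P₂ * m) = Nat.card L := by rw [hm, ← hmul]; ring
        rw [this]
        refine dvd_trans ?_ (card_dvd_of_le (inf_le_left : L' ≤ L))
        rw [hm']
        exact mul_dvd_mul_left _ hqm
      have h5 := Nat.dvd_of_mul_dvd_mul_left Nat.card_pos h4
      rcases hq.dvd_mul.1 h5 with h | h
      · have := card_isPGroup_coprime hp hq (isPGroup_primesPart hp) h
        exact hpQ (this ▸ hqQ)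
      · exact hq.ne_one (Nat.eq_one_of_dvd_coprimes hcop (hqQ.trans (card_dvd_of_le hQ2R)) h)) rfl
  refine ⟨l' * l, mul_mem hl'.1 hl, fun x hx => ?_⟩
  have hxR : l * x * l⁻¹ ∈ R := ⟨x, hx, rfl⟩
  obtain ⟨u, hu, v, hv, huv⟩ := exists_mul_of_mem {p} hxR
  have h6 : l' * l * x * (l' * l)⁻¹ = u * (l' * v * l'⁻¹) := by
    have h7 := mem_centralizer_iff.1 hl'.2 u (hPle hu)
    calc l' * l * x * (l' * l)⁻¹ = l' * (l * x * l⁻¹) * l'⁻¹ := by group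
      _ = (l' * u) * v * l'⁻¹ := by rw [huv]; group
      _ = _ := by rw [← h7]; group
  rw [h6]
  exact mul_mem (hP2R (hPle hu)) (hQ2R (hlQ v hv))

end

section

open Subgroup
open scoped commutatorElement
variable {G : Type*} [Group G]

theorem eq_bot_of_le_commutator {P T : Subgroup G} [Group.IsNilpotent P] (hT : T ≤ P)
    (h : T ≤ ⁅T, P⁆) : T = ⊥ := by
  obtain ⟨n, hn⟩ := Subgroup.nilpotent_iff_lowerCentralSeries.1 ‹Group.IsNilpotent P›
  have key : ∀ n, T ≤ ((⊤ : Subgroup P).lowerCentralSeries n).map P.subtype := by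
    intro n
    induction n with
    | zero => simpa [← MonoidHom.range_eq_map] using hT
    | succ n ih =>
      refine h.trans ((commutator_mono ih le_rfl).trans ?_)
      rw [Subgroup.lowerCentralSeries_succ, map_commutator]
      refine commutator_mono le_rfl (by simp [← MonoidHom.range_eq_map])
  have := key n
  rw [hn] at this
  simpa using this

theorem not_dvd_card_primesPart_compl_of_fusion [Finite G] {r : ℕ} (hr : r.Prime) {C P : Subgroup G}
    (hP : P ≤ C) (hPr : IsPGroup r P) {m : ℕ} (hm : Nat.card C = Nat.card P * m) (hrm : ¬ r ∣ m)
    (hf : ∀ x ∈ P, ∀ c ∈ C, c * x * c⁻¹ ∈ P → ∃ u ∈ P, c * x * c⁻¹ = u * x * u⁻¹) :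
    ¬ r ∣ Nat.card (primesPart {r}ᶜ C) := by
  have := Fact.mk hr
  set K := primesPart {r}ᶜ C with hK
  have hKC : K ≤ C := primesPart_le _ _
  obtain ⟨S⟩ : Nonempty (Sylow r K) := inferInstance
  set T := (S : Subgroup K).map K.subtype with hT
  have hTK : T ≤ K := map_subtype_le _
  have hTr : IsPGroup r T := S.2.map _
  obtain ⟨l, hl, hlT⟩ := exists_conj_le_of_isPGroup hr (hTK.trans hKC) hP hTr hPr hm hrm
  set P' := P.map (MulAut.conj l⁻¹).toMonoidHom with hP'
  have hTP : T ≤ P' := fun x hx => mem_map_conj.2 (by simpa using hlT x hx)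
  have hPnil : Group.IsNilpotent P' := (hPr.map _).isNilpotent
  -- a Sylow subgroup of `K` is contained in its commutator with `P'`
  have hfoc : focalSubgroup (S : Subgroup K) ≤ ⁅T, P'⁆.subgroupOf K := by
    rw [focalSubgroup_def, closure_le]
    rintro g ⟨hg, x, hx, u, rfl⟩
    have hxT : (x : G) ∈ T := ⟨x, hx, rfl⟩
    have hxP := hTP hxT
    have hu : (u : G) * (x : G)⁻¹ * (u : G)⁻¹ ∈ P' := by
      have h1 : u * x⁻¹ * u⁻¹ ∈ (S : Subgroup K) := by
        have := mul_mem (inv_mem hx) hg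
        simpa [commutatorElement_def, mul_assoc] using this
      exact hTP ⟨_, h1, rfl⟩
    rw [mem_map_conj] at hu hxP
    obtain ⟨w, hw, hw2⟩ := hf (l * (x : G)⁻¹ * l⁻¹) (by simpa [mul_assoc] using inv_mem hxP)
      (l * u * l⁻¹)
      (mul_mem (mul_mem hl (hKC u.2)) (inv_mem hl)) (by simpa [mul_assoc] using hu)
    have h2 : ((⁅x, u⁆ : K) : G) = ⁅(x : G), l⁻¹ * w * l⁆ := by
      have h3 : (u : G) * (x : G)⁻¹ * (u : G)⁻¹ = l⁻¹ * w * l * (x : G)⁻¹ * (l⁻¹ * w * l)⁻¹ := by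
        calc (u : G) * (x : G)⁻¹ * (u : G)⁻¹
            = l⁻¹ * (l * u * l⁻¹ * (l * (x : G)⁻¹ * l⁻¹) * (l * u * l⁻¹)⁻¹) * l := by group
          _ = _ := by rw [hw2]; group
      simp only [commutatorElement_def, Subgroup.coe_mul, Subgroup.coe_inv] at *
      rw [mul_assoc (x : G), mul_assoc (x : G), h3]
      group
    change ((⁅x, u⁆ : K) : G) ∈ ⁅T, P'⁆
    rw [h2]
    exact commutator_mem_commutator hxT (mem_map_conj.2 (by simpa [mul_assoc] using hw))
  have htriv : K ≤ S.transferFocal.ker.map K.subtype := by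
    conv_lhs => rw [hK, primesPart]
    rw [closure_le]
    rintro x ⟨hx, hx2⟩
    have hxK : x ∈ K := mem_primesPart_of hx hx2
    refine ⟨⟨x, hxK⟩, ?_, rfl⟩
    rw [SetLike.mem_coe, MonoidHom.mem_ker]
    have h1 : IsPrimesElt {r}ᶜ (⟨x, hxK⟩ : K) := isPrimesElt_coe.1 hx2
    have h2 := isPrimesElt_map (transferFocal (S : Subgroup K)) h1
    refine eq_one_of_isPrimesElt (disjoint_compl_right (a := {r})) ?_ h2
    exact (isPrimesElt_singleton_iff hr).2 ((S.2.to_quotient _) _)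
  have htop : focalSubgroupOf (S : Subgroup K) = ⊤ := by
    rw [eq_top_iff]
    intro y _
    obtain ⟨k, hk⟩ := transferFocal_surjective (P := S) (QuotientGroup.mk y)
    obtain ⟨k', hk', h⟩ := htriv k.2
    rw [Subtype.ext h] at hk'
    rw [← QuotientGroup.eq_one_iff, ← hk]
    exact hk'
  have hTle : T ≤ ⁅T, P'⁆ := by
    rintro _ ⟨y, hy, rfl⟩
    have : (⟨y, hy⟩ : (S : Subgroup K)) ∈ focalSubgroupOf (S : Subgroup K) := by rw [htop]; trivial
    exact hfoc (mem_subgroupOf.1 this)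
  have hTbot := eq_bot_of_le_commutator hTP hTle
  intro hd
  have h1 := S.dvd_card_of_dvd_card hd
  have h2 : (S : Subgroup K) = ⊥ := by
    rw [eq_bot_iff]
    intro y hy
    have : (y : G) ∈ T := ⟨y, hy, rfl⟩
    rw [hTbot] at this
    exact Subtype.ext this
  rw [h2] at h1
  simp at h1
  exact hr.ne_one h1

end

theorem eq_of_isIntegral_average {d n : ℕ} (hd : 0 < d) (hn : 0 < n) (ζ : Fin d → ℂ) (hζ : ∀ j,
    ζ j ^ n = 1)
    (h0 : ∑ j, ζ j ≠ 0) (hω_int : IsIntegral ℤ ((∑ j, ζ j) / d)) : ∃ u, ∀ j, ζ j = u := by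
  have hd' : (d : ℂ) ≠ 0 := by exact_mod_cast hd.ne'
  have hdR : (0 : ℝ) < d := by exact_mod_cast hd
  have norm_of_pow : ∀ z : ℂ, z ^ n = 1 → ‖z‖ = 1 := fun z hz =>
    Complex.norm_eq_one_of_pow_eq_one hz hn.ne'
  set α := (∑ j, ζ j) / d with hα
  have hα0 : α ≠ 0 := div_ne_zero h0 hd'
  let K := IntermediateField.adjoin ℚ (Set.range ζ)
  have : FiniteDimensional ℚ K := by
    refine IntermediateField.finiteDimensional_adjoin ?_
    rintro _ ⟨j, rfl⟩
    exact IsIntegral.of_pow hn (by rw [hζ]; exact isIntegral_one)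
  have : NumberField K := ⟨⟩
  let z : Fin d → K := fun j => ⟨ζ j, IntermediateField.subset_adjoin _ _ ⟨j, rfl⟩⟩
  have hz : ∀ j, z j ^ n = 1 := fun j => Subtype.ext (hζ j)
  let x : K := (∑ j, z j) / d
  have hx : (x : ℂ) = α := by
    simp [x, z, hα]
  have hx0 : x ≠ 0 := by
    intro h; apply hα0; rw [← hx, h]; rfl
  have hxi : IsIntegral ℤ x := by
    rw [← hx] at hω_int
    exact (isIntegral_algHom_iff (K.val.restrictScalars ℤ) K.val.injective).1 hω_int
  have hle : ∀ φ : K →+* ℂ, ‖φ x‖ ≤ 1 := by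
    intro φ
    have : φ x = (∑ j, φ (z j)) / d := by simp [x]
    rw [this, norm_div, Complex.norm_natCast, div_le_one hdR]
    refine (norm_sum_le _ _).trans ?_
    have h1 : ∀ j, ‖φ (z j)‖ = 1 := fun j => norm_of_pow _ (by rw [← map_pow, hz, map_one])
    simp [h1]
  obtain ⟨m, hm, hxm⟩ := NumberField.Embeddings.pow_eq_one_of_norm_le_one K ℂ hx0 hxi hle
  have hnorm : ‖α‖ = 1 := by
    refine Complex.norm_eq_one_of_pow_eq_one (n := m) ?_ (by omega)
    rw [← hx, ← IntermediateField.coe_pow, hxm]; rfl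
  have hconj : α * (starRingEnd ℂ) α = 1 := by
    rw [Complex.mul_conj, Complex.normSq_eq_norm_sq, hnorm]; simp
  have hre : ∀ j, (ζ j * (starRingEnd ℂ) α).re ≤ 1 := fun j => by
    refine (Complex.re_le_norm _).trans ?_
    rw [norm_mul, norm_of_pow _ (hζ j), Complex.norm_conj, hnorm, one_mul]
  have hsum : ∑ j, (ζ j * (starRingEnd ℂ) α).re = ∑ j : Fin d, (1 : ℝ) := by
    rw [← Complex.re_sum, ← Finset.sum_mul]
    have : ∑ j, ζ j = d * α := by rw [hα]; field_simp
    rw [this, mul_assoc, hconj]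
    simp
  have heq := (Finset.sum_eq_sum_iff_of_le fun j _ => hre j).1 hsum
  refine ⟨α, fun j => ?_⟩
  have h1 : (ζ j * (starRingEnd ℂ) α).re = 1 := heq j (Finset.mem_univ j)
  have h2 : ‖ζ j * (starRingEnd ℂ) α‖ = 1 := by
    rw [norm_mul, norm_of_pow _ (hζ j), Complex.norm_conj, hnorm, one_mul]
  have h3 : (ζ j * (starRingEnd ℂ) α) = 1 := by
    have h4 := Complex.sq_norm_sub_sq_re (ζ j * (starRingEnd ℂ) α)
    rw [h1, h2] at h4
    apply Complex.ext
    · simpa using h1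
    · have : (ζ j * (starRingEnd ℂ) α).im ^ 2 = 0 := by rw [← h4]; norm_num
      simpa using this
  calc ζ j = (ζ j * (starRingEnd ℂ) α) * α := by rw [mul_assoc, mul_comm _ α, hconj, mul_one]
    _ = α := by rw [h3, one_mul]

open Polynomial in
theorem Matrix.eq_smul_one_of_pow_eq_one {d n : ℕ} (hn : 0 < n) (M : Matrix (Fin d) (Fin d) ℂ)
    (hM : M ^ n = 1)
    {u : ℂ} (hu : ∀ z ∈ M.charpoly.roots, z = u) : M = u • 1 := by
  by_cases hd : d = 0
  · subst hd
    ext i; exact i.elim0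
  have hchar : M.charpoly = (X - C u) ^ d := by
    have h1 := (IsAlgClosed.splits M.charpoly).eq_prod_roots_of_monic (M.charpoly_monic)
    have h2 : M.charpoly.roots = Multiset.replicate d u := by
      rw [Multiset.eq_replicate]
      refine ⟨?_, hu⟩
      rw [← (IsAlgClosed.splits M.charpoly).natDegree_eq_card_roots,
        Matrix.charpoly_natDegree_eq_dim,
        Fintype.card_fin]
    rw [h1, h2]
    simp
  have hpow : aeval M ((X - C u) ^ d) = 0 := by rw [← hchar, Matrix.aeval_self_charpoly]
  have hsep : (X ^ n - 1 : ℂ[X]).Separable := by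
    rw [X_pow_sub_one_separable_iff]; exact_mod_cast hn.ne'
  have hXn : aeval M (X ^ n - 1 : ℂ[X]) = 0 := by simp [hM]
  have hdvd : (minpoly ℂ M) ∣ (X - C u) := by
    have hi := minpoly.dvd ℂ M hXn
    have hj := minpoly.dvd ℂ M hpow
    have hsq := (hsep.of_dvd hi).squarefree
    exact (hsq.dvd_pow_iff_dvd hd).1 hj
  obtain ⟨q, hq⟩ := hdvd
  have : aeval M (X - C u) = 0 := by rw [hq, map_mul, minpoly.aeval, zero_mul]
  simpa [sub_eq_zero, Algebra.algebraMap_eq_smul_one] using this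

theorem trace_mulLeft_pi_matrix {ι : Type*} [Fintype ι] [DecidableEq ι] (d : ι → ℕ)
    (x : Π i, Matrix (Fin (d i)) (Fin (d i)) ℂ) :
    LinearMap.trace ℂ _ (LinearMap.mulLeft ℂ x) = ∑ i, d i * (x i).trace := by
  classical
  rw [LinearMap.trace_eq_matrix_trace ℂ (Pi.basis fun i => Matrix.stdBasis ℂ (Fin (d i))
    (Fin (d i))),
    Matrix.trace, Fintype.sum_sigma]
  refine Finset.sum_congr rfl fun i _ => ?_
  rw [Fintype.sum_prod_type]
  have : ∀ a b : Fin (d i), (LinearMap.toMatrix (Pi.basis fun i => Matrix.stdBasis ℂ (Fin (d i))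
    (Fin (d i)))
      (Pi.basis fun i => Matrix.stdBasis ℂ (Fin (d i)) (Fin (d i))) (LinearMap.mulLeft ℂ x)).diag
        ⟨i, (a, b)⟩
      = x i a a := by
    intro a b
    rw [Matrix.diag_apply, LinearMap.toMatrix_apply, Pi.basis_repr, Pi.basis_apply]
    simp only [LinearMap.mulLeft_apply, Pi.mul_apply, Pi.single_eq_same, Matrix.stdBasis_eq_single]
    simp [Matrix.stdBasis, Matrix.mul_apply]
    rw [Finset.sum_eq_single a (fun j _ hj => by simp [Ne.symm hj]) (by simp)]
    simp
  simp_rw [this]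
  simp [Matrix.trace, Finset.mul_sum]

theorem trace_mulLeft_single {G : Type*} [Group G] [Finite G] {g : G} (hg : g ≠ 1) :
    LinearMap.trace ℂ _ (LinearMap.mulLeft ℂ (MonoidAlgebra.single g (1 : ℂ))) = 0 := by
  classical
  have := Fintype.ofFinite G
  let b : Module.Basis G ℂ (MonoidAlgebra ℂ G) := MonoidAlgebra.basis G ℂ
  rw [LinearMap.trace_eq_matrix_trace ℂ b, Matrix.trace]
  refine Finset.sum_eq_zero fun h _ => ?_
  have h1 : LinearMap.mulLeft ℂ (MonoidAlgebra.single g (1 : ℂ)) (b h) = b (g * h) := by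
    simp [b, MonoidAlgebra.single_mul_single]
  rw [Matrix.diag_apply, LinearMap.toMatrix_apply, h1, Module.Basis.repr_self_apply, if_neg]
  simpa using hg

open Classical in
theorem exists_irreducible_matrix_representations (G : Type*) [Group G] [Finite G] :
    ∃ (n : ℕ) (d : Fin n → ℕ) (ρ : ∀ i, G →* Matrix (Fin (d i)) (Fin (d i)) ℂ),
      (∀ i, 0 < d i) ∧ (∀ g ≠ 1, ∑ i, (d i : ℂ) * (ρ i g).trace = 0) ∧
      (∀ i X, (∀ g, X * ρ i g = ρ i g * X) → ∃ c : ℂ, X = c • 1) ∧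
      ∃! i, ∀ g, ρ i g = 1 := by
  have := Fintype.ofFinite G
  have : NeZero (Nat.card G : ℂ) := ⟨by exact_mod_cast Nat.card_pos.ne'⟩
  obtain ⟨n, d, hd, ⟨e⟩⟩ :=
    IsSemisimpleRing.exists_algEquiv_pi_matrix_of_isAlgClosed ℂ (MonoidAlgebra ℂ G)
  let ε : ∀ i, MonoidAlgebra ℂ G →ₐ[ℂ] Matrix (Fin (d i)) (Fin (d i)) ℂ := fun i =>
    (Pi.evalAlgHom ℂ (fun i => Matrix (Fin (d i)) (Fin (d i)) ℂ) i).comp e.toAlgHom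
  let ρ : ∀ i, G →* Matrix (Fin (d i)) (Fin (d i)) ℂ := fun i =>
    (ε i : MonoidAlgebra ℂ G →* _).comp (MonoidAlgebra.of ℂ G)
  have hρ : ∀ i g, ρ i g = e (MonoidAlgebra.single g 1) i := fun i g => rfl
  have hcomm : ∀ i X, (∀ g, X * ρ i g = ρ i g * X) → ∃ c : ℂ, X = c • 1 := by
    intro i X hX
    have h1 : ∀ a : MonoidAlgebra ℂ G, X * ε i a = ε i a * X := by
      intro a
      induction a using MonoidAlgebra.induction_on with
      | of g => exact hX g
      | add a b ha hb => rw [map_add, mul_add, add_mul, ha, hb]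
      | smul r a ha => rw [map_smul, mul_smul_comm, smul_mul_assoc, ha]
    have h2 : X ∈ Subalgebra.center ℂ (Matrix (Fin (d i)) (Fin (d i)) ℂ) := by
      rw [Subalgebra.mem_center_iff]
      intro Y
      have : ε i (e.symm (Pi.single i Y)) = Y := by simp [ε]
      rw [← this, h1]
    rw [Algebra.IsCentral.center_eq_bot, Algebra.mem_bot] at h2
    obtain ⟨c, hc⟩ := h2
    exact ⟨c, by rw [← hc, Algebra.algebraMap_eq_smul_one]⟩
  have hd' : ∀ i, 0 < d i := fun i => Nat.pos_of_ne_zero (hd i).out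
  refine ⟨n, d, ρ, hd', ?_, hcomm, ?_⟩
  · intro g hg
    have h1 := trace_mulLeft_single hg
    rw [← LinearMap.trace_conj' _ e.toLinearEquiv] at h1
    rw [← h1]
    have : e.toLinearEquiv.conj (LinearMap.mulLeft ℂ (MonoidAlgebra.single g (1 : ℂ))) =
        LinearMap.mulLeft ℂ (e (MonoidAlgebra.single g (1 : ℂ))) := by
      refine LinearMap.ext fun x => ?_
      simp [LinearEquiv.conj_apply]
    rw [this, trace_mulLeft_pi_matrix]
    rfl
  · let s : MonoidAlgebra ℂ G := ∑ h, MonoidAlgebra.single h 1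
    have hs1 : ∀ g, s * MonoidAlgebra.single g 1 = s := by
      intro g
      simp only [s, Finset.sum_mul, MonoidAlgebra.single_mul_single, mul_one]
      exact Fintype.sum_equiv (Equiv.mulRight g) _ _ fun _ => rfl
    have hs2 : ∀ g, MonoidAlgebra.single g 1 * s = s := by
      intro g
      simp only [s, Finset.mul_sum, MonoidAlgebra.single_mul_single, mul_one]
      exact Fintype.sum_equiv (Equiv.mulLeft g) _ _ fun _ => rfl
    have hs0 : s ≠ 0 := by
      intro h
      have h1 : (MonoidAlgebra.basis G ℂ).repr s 1 = 0 := by rw [h]; simp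
      have h2 : s = ∑ h, MonoidAlgebra.basis G ℂ h := by simp [s]
      rw [h2, map_sum] at h1
      simp only [Module.Basis.repr_self, Finsupp.finsetSum_apply, Finsupp.single_apply] at h1
      simp at h1
    have hex : ∃ i, e s i ≠ 0 := by
      by_contra! hc
      apply hs0
      apply e.injective
      rw [map_zero]
      exact funext hc
    obtain ⟨i, hi⟩ := hex
    have hl : ∀ g, e s i * ρ i g = e s i := fun g => by
      rw [hρ, ← Pi.mul_apply, ← map_mul, hs1]
    have hr : ∀ g, ρ i g * e s i = e s i := fun g => by
      rw [hρ, ← Pi.mul_apply, ← map_mul, hs2]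
    obtain ⟨c, hc⟩ := hcomm i (e s i) fun g => by rw [hl, hr]
    have hc0 : c ≠ 0 := by rintro rfl; exact hi (by simpa using hc)
    refine ⟨i, fun g => ?_, fun j hj => ?_⟩
    · have := hl g
      rw [hc, smul_mul_assoc, one_mul] at this
      exact smul_right_injective _ hc0 this
    · by_contra hij
      have hi1 : ∀ g, ρ i g = 1 := fun g => by
        have := hl g
        rw [hc, smul_mul_assoc, one_mul] at this
        exact smul_right_injective _ hc0 this
      have key : ∀ a : MonoidAlgebra ℂ G, ∃ r : ℂ, ε i a = r • 1 ∧ ε j a = r • 1 := by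
        intro a
        induction a using MonoidAlgebra.induction_on with
        | of g => exact ⟨1, by rw [one_smul]; exact hi1 g, by rw [one_smul]; exact hj g⟩
        | add a b ha hb =>
          obtain ⟨r, h1, h2⟩ := ha
          obtain ⟨r', h3, h4⟩ := hb
          exact ⟨r + r', by rw [map_add, h1, h3, add_smul], by rw [map_add, h2, h4, add_smul]⟩
        | smul t a ha =>
          obtain ⟨r, h1, h2⟩ := ha
          exact ⟨t * r, by rw [map_smul, h1, mul_smul], by rw [map_smul, h2, mul_smul]⟩
      obtain ⟨r, h1, h2⟩ := key (e.symm (Pi.single i 1))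
      have h3 : ε i (e.symm (Pi.single i 1)) = 1 := by simp [ε]
      have h4 : ε j (e.symm (Pi.single i 1)) = 0 := by simp [ε, hij]
      have := hd i
      have := hd j
      rw [h4, eq_comm, smul_eq_zero] at h2
      rcases h2 with h2 | h2
      · rw [h3, h2, zero_smul] at h1
        exact one_ne_zero h1
      · exact one_ne_zero h2

theorem Matrix.exists_roots_of_pow_eq_one {d n : ℕ} (hd : 0 < d) (M : Matrix (Fin d) (Fin d) ℂ)
    (hM : M ^ n = 1) :
    ∃ ζ : Fin d → ℂ, (∀ j, ζ j ^ n = 1) ∧ ∑ j, ζ j = M.trace ∧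
      ∀ z ∈ M.charpoly.roots, ∃ j, ζ j = z := by
  have : NeZero d := ⟨hd.ne'⟩
  have hroot : ∀ z ∈ M.charpoly.roots, z ^ n = 1 := by
    intro z hz
    have h1 : z ∈ spectrum ℂ M :=
      Matrix.mem_spectrum_iff_isRoot_charpoly.2 (Polynomial.isRoot_of_mem_roots hz)
    have h2 := spectrum.pow_mem_pow M n h1
    rw [hM, spectrum.one_eq] at h2
    exact h2
  have hlen : M.charpoly.roots.toList.length = d := by
    rw [Multiset.length_toList, ← (IsAlgClosed.splits M.charpoly).natDegree_eq_card_roots,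
      Matrix.charpoly_natDegree_eq_dim, Fintype.card_fin]
  refine ⟨fun j => M.charpoly.roots.toList[j]'(by rw [hlen]; exact j.2), fun j => ?_,
    ?_, fun z hz => ?_⟩
  · exact hroot _ (Multiset.mem_toList.1 (List.getElem_mem _))
  · rw [Matrix.trace_eq_sum_roots_charpoly, ← Multiset.sum_toList, ← Fin.sum_univ_getElem]
    exact Fintype.sum_equiv (finCongr hlen.symm) _ _ fun _ => rfl
  · obtain ⟨j, hj, h⟩ := List.mem_iff_getElem.1 (Multiset.mem_toList.2 hz)
    exact ⟨⟨j, hlen ▸ hj⟩, h⟩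

theorem Matrix.isIntegral_trace_of_pow_eq_one {d n : ℕ} (hd : 0 < d) (hn : 0 < n)
    (M : Matrix (Fin d) (Fin d) ℂ) (hM : M ^ n = 1) : IsIntegral ℤ M.trace := by
  obtain ⟨ζ, hζ, h, -⟩ := M.exists_roots_of_pow_eq_one hd hM
  rw [← h]
  exact IsIntegral.sum _ fun j _ => IsIntegral.of_pow hn (by rw [hζ]; exact isIntegral_one)

theorem isIntegral_index_mul_trace_div {G : Type*} [Group G] [Finite G] {d : ℕ} (hd : 0 < d)
    (ρ : G →* Matrix (Fin d) (Fin d) ℂ)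
    (hρ : ∀ X, (∀ g, X * ρ g = ρ g * X) → ∃ c : ℂ, X = c • 1) (g : G) :
    IsIntegral ℤ ((Subgroup.centralizer {g}).index * (ρ g).trace / d) := by
  classical
  have hd' : (d : ℂ) ≠ 0 := by exact_mod_cast hd.ne'
  have : NeZero d := ⟨hd.ne'⟩
  let Q := G ⧸ Subgroup.centralizer {g}
  have := Fintype.ofFinite Q
  let f : Q → G := Quotient.lift (fun h : G => h * g * h⁻¹) (by
    intro a b hab
    have hab' : a⁻¹ * b ∈ Subgroup.centralizer {g} := QuotientGroup.leftRel_apply.1 hab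
    rw [Subgroup.mem_centralizer_singleton_iff] at hab'
    have h2 : b = a * (a⁻¹ * b) := by group
    change a * g * a⁻¹ = b * g * b⁻¹
    generalize a⁻¹ * b = c at hab' h2
    subst h2
    rw [mul_assoc a c g, hab']
    group)
  have hf : ∀ (x : G) (q : Q), f (x • q) = x * f q * x⁻¹ := by
    intro x q
    induction q using QuotientGroup.induction_on with
    | H h => change x * h * g * (x * h)⁻¹ = x * (h * g * h⁻¹) * x⁻¹; group
  let z : MonoidAlgebra ℤ G := ∑ q : Q, MonoidAlgebra.single (f q) 1
  let φ := MonoidAlgebra.lift ℤ (Matrix (Fin d) (Fin d) ℂ) G ρ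
  have hφz : φ z = ∑ q : Q, ρ (f q) := by
    simp [φ, z, map_sum]
  have hcen : ∀ x, φ z * ρ x = ρ x * φ z := by
    intro x
    rw [hφz, Finset.sum_mul, Finset.mul_sum]
    rw [← Equiv.sum_comp (MulAction.toPerm x)]
    refine Finset.sum_congr rfl fun q _ => ?_
    rw [MulAction.toPerm_apply, hf, ← map_mul, ← map_mul]
    group
  obtain ⟨ω, hω⟩ := hρ _ hcen
  have hω_int : IsIntegral ℤ ω := by
    have h1 : IsIntegral ℤ (φ z) := (IsIntegral.of_finite ℤ z).map φ
    rw [hω, ← Algebra.algebraMap_eq_smul_one] at h1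
    exact (isIntegral_algebraMap_iff (algebraMap ℂ (Matrix (Fin d) (Fin d) ℂ)).injective).1 h1
  have htr : ∀ q, (ρ (f q)).trace = (ρ g).trace := by
    intro q
    induction q using QuotientGroup.induction_on with
    | H h =>
      change (ρ (h * g * h⁻¹)).trace = _
      rw [map_mul, Matrix.trace_mul_comm, ← map_mul]
      congr 2
      group
  have h2 : ω * d = (Subgroup.centralizer {g}).index * (ρ g).trace := by
    have h3 := congrArg Matrix.trace hω
    rw [hφz, Matrix.trace_sum] at h3
    simp only [htr] at h3
    simp only [Finset.sum_const, nsmul_eq_mul, Matrix.trace_smul, Matrix.trace_one,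
      Fintype.card_fin, smul_eq_mul] at h3
    rw [← h3, Finset.card_univ, ← Nat.card_eq_fintype_card]
    rfl
  rw [← h2, mul_div_cancel_right₀ _ hd']
  exact hω_int

theorem not_isIntegral_inv_prime {p : ℕ} (hp : p.Prime) : ¬ IsIntegral ℤ ((p : ℂ)⁻¹) := by
  intro h
  have h1 : IsIntegral ℤ ((p : ℚ)⁻¹) := by
    rw [← isIntegral_algebraMap_iff (B := ℂ) (algebraMap ℚ ℂ).injective]
    simpa using h
  obtain ⟨m, hm⟩ := IsIntegrallyClosed.isIntegral_iff.1 h1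
  have hp0 : (p : ℚ) ≠ 0 := by exact_mod_cast hp.ne_zero
  have h2 : (m * p : ℚ) = 1 := by
    have : (m : ℚ) = (p : ℚ)⁻¹ := by simpa using hm
    rw [this, inv_mul_cancel₀ hp0]
  have h3 : m * p = 1 := by exact_mod_cast h2
  have h4 : (p : ℤ) ∣ 1 := ⟨m, by rw [mul_comm, h3]⟩
  exact hp.one_lt.ne' (by exact_mod_cast Int.eq_one_of_dvd_one (by positivity) h4)

theorem index_centralizer_ne_prime_pow {G : Type*} [Group G] [Finite G] [IsSimpleGroup G]
    (hna : ¬ ∀ x y : G, x * y = y * x) {g : G} (hg : g ≠ 1) {p : ℕ} (hp : p.Prime) (k : ℕ) :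
    (Subgroup.centralizer {g}).index ≠ p ^ k := by
  classical
  intro hidx
  obtain ⟨n, d, ρ, hd, hsum, hcomm, i₀, hi₀, huniq⟩ := exists_irreducible_matrix_representations G
  have hn : 0 < orderOf g := orderOf_pos g
  have hpow : ∀ i, ρ i g ^ orderOf g = 1 := fun i => by rw [← map_pow, pow_orderOf_eq_one, map_one]
  have hchar : ∀ i, IsIntegral ℤ (ρ i g).trace := fun i =>
    (ρ i g).isIntegral_trace_of_pow_eq_one (hd i) hn (hpow i)
  have hd1 : d i₀ = 1 := by
    by_contra h1
    have h2 : 1 < d i₀ := by have := hd i₀; omega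
    obtain ⟨c, hc⟩ := hcomm i₀ (Matrix.single ⟨0, hd i₀⟩ ⟨1, h2⟩ 1) fun x => by
      rw [hi₀, mul_one, one_mul]
    have := congrFun (congrFun hc ⟨0, hd i₀⟩) ⟨1, h2⟩
    simp at this
  have hex : ∃ i, i ≠ i₀ ∧ ¬ p ∣ d i ∧ (ρ i g).trace ≠ 0 := by
    by_contra! hcon
    apply not_isIntegral_inv_prime hp
    have h0 := hsum g hg
    rw [← Finset.add_sum_erase _ _ (Finset.mem_univ i₀), hi₀, Matrix.trace_one, Fintype.card_fin,
      hd1] at h0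
    have hterm : ∀ i ∈ Finset.univ.erase i₀, ∃ β : ℂ, IsIntegral ℤ β ∧
        (d i : ℂ) * (ρ i g).trace = p * β := by
      intro i hi
      by_cases hpd : p ∣ d i
      · obtain ⟨m, hm⟩ := hpd
        refine ⟨m * (ρ i g).trace, (isIntegral_algebraMap (x := (m : ℤ))).mul (hchar i), ?_⟩
        have hm' : (d i : ℂ) = p * m := by exact_mod_cast hm
        rw [hm', mul_assoc]
      · exact ⟨0, isIntegral_zero, by rw [hcon i (Finset.ne_of_mem_erase hi) hpd]; simp⟩
    choose! β hβ hβ' using hterm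
    rw [Finset.sum_congr rfl hβ', ← Finset.mul_sum] at h0
    have hp0 : (p : ℂ) ≠ 0 := by exact_mod_cast hp.ne_zero
    have : (p : ℂ)⁻¹ = - ∑ i ∈ Finset.univ.erase i₀, β i := by
      field_simp
      push_cast at h0
      linear_combination h0
    rw [this]
    exact (IsIntegral.sum _ hβ).neg
  obtain ⟨i, hi, hpd, hχ⟩ := hex
  have hd0 : (d i : ℂ) ≠ 0 := by exact_mod_cast (hd i).ne'
  have hav : IsIntegral ℤ ((ρ i g).trace / d i) := by
    have h1 := isIntegral_index_mul_trace_div (hd i) (ρ i) (hcomm i) g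
    rw [hidx] at h1
    have hcop : IsCoprime ((p ^ k : ℕ) : ℤ) (d i : ℤ) :=
      Nat.isCoprime_iff_coprime.2 (Nat.Coprime.pow_left k ((hp.coprime_iff_not_dvd).2 hpd))
    obtain ⟨u, v, huv⟩ := hcop
    have h2 : (ρ i g).trace / d i =
        u * (((p ^ k : ℕ) : ℂ) * (ρ i g).trace / d i) + v * (ρ i g).trace := by
      have : (u : ℂ) * (p ^ k : ℕ) + v * d i = 1 := by exact_mod_cast huv
      field_simp
      linear_combination - this
    rw [h2]
    exact ((isIntegral_algebraMap (x := u)).mul h1).add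
      ((isIntegral_algebraMap (x := v)).mul (hchar i))
  obtain ⟨ζ, hζ, hζs, hζr⟩ := (ρ i g).exists_roots_of_pow_eq_one (hd i) (hpow i)
  rw [← hζs] at hav hχ
  obtain ⟨u, hu⟩ := eq_of_isIntegral_average (hd i) hn ζ hζ hχ hav
  have hsc : ρ i g = u • 1 := Matrix.eq_smul_one_of_pow_eq_one hn _ (hpow i) fun z hz => by
    obtain ⟨j, rfl⟩ := hζr z hz
    exact hu j
  rcases (inferInstance : (ρ i).ker.Normal).eq_bot_or_eq_top with hker | hker
  · have hcen : ∀ x, x * g = g * x := fun x => by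
      apply (MonoidHom.ker_eq_bot_iff (ρ i)).1 hker
      rw [map_mul, map_mul, hsc, mul_smul_one, smul_one_mul]
    rcases (inferInstance : (Subgroup.center G).Normal).eq_bot_or_eq_top with hc | hc
    · exact hg (Subgroup.mem_bot.1 (hc ▸ Subgroup.mem_center_iff.2 hcen))
    · exact hna fun x y => (Subgroup.mem_center_iff.1 (hc ▸ Subgroup.mem_top y)) x
  · exact hi (huniq i fun x => MonoidHom.mem_ker.1 (hker ▸ Subgroup.mem_top x))

section

open Subgroup

section
variable {G : Type*} [Group G]

theorem normalizer_ne_top_of_ne [IsSimpleGroup G] {K : Subgroup G} (h0 : K ≠ ⊥) (h1 : K ≠ ⊤) :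
    normalizer (K : Set G) ≠ ⊤ := by
  intro h
  have : K.Normal := normalizer_eq_top_iff.1 h
  exact this.eq_bot_or_eq_top.elim h0 h1

theorem centralizer_ne_top_of_ne_one [IsSimpleGroup G] (hna : ¬ ∀ x y : G, x * y = y * x) {z : G}
    (hz : z ≠ 1) : centralizer ({z} : Set G) ≠ ⊤ := by
  intro h
  have hcen : z ∈ center G :=
    mem_center_iff.2 fun g => mem_centralizer_singleton_iff.1 (h ▸ mem_top g)
  rcases (inferInstance : (center G).Normal).eq_bot_or_eq_top with hc | hc
  · exact hz (mem_bot.1 (hc ▸ hcen))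
  · exact hna fun x y => (mem_center_iff.1 (hc ▸ mem_top y)) x

theorem mem_of_pow_mem_of_coprime {K : Subgroup G} {a : G} {m n : ℕ} (hmn : m.Coprime n)
    (hm : a ^ m ∈ K) (hn : a ^ n ∈ K) : a ∈ K := by
  have h := Nat.gcd_eq_gcd_ab m n
  rw [hmn] at h
  have h2 : a = (a ^ m) ^ (m.gcdA n) * (a ^ n) ^ (m.gcdB n) := by
    rw [← zpow_natCast, ← zpow_natCast, ← zpow_mul, ← zpow_mul, ← zpow_add, ← h]
    simp
  rw [h2]
  exact K.mul_mem (K.zpow_mem hm _) (K.zpow_mem hn _)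

theorem pow_card_of_mem {H : Subgroup G} {x : G} (hx : x ∈ H) : x ^ Nat.card H = 1 :=
  congrArg Subtype.val (pow_card_eq_one' (x := (⟨x, hx⟩ : H)))

/-- `H` is factorised by `A` and `B` if `H = (A ⊓ H) (B ⊓ H)`. -/
def IsFactorised (A B H : Subgroup G) : Prop :=
  ∀ h ∈ H, ∃ a ∈ A, ∃ b ∈ B, a ∈ H ∧ b ∈ H ∧ h = a * b

theorem IsFactorised.symm {A B H : Subgroup G} (h : IsFactorised A B H) : IsFactorised B A H := by
  intro x hx
  obtain ⟨a, ha, b, hb, ha', hb', hab⟩ := h x⁻¹ (H.inv_mem hx)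
  refine ⟨b⁻¹, B.inv_mem hb, a⁻¹, A.inv_mem ha, H.inv_mem hb', H.inv_mem ha', ?_⟩
  rw [← mul_inv_rev, ← hab, inv_inv]

theorem IsFactorised.of_le_normalizer [Finite G] {A B H K : Subgroup G} (h : IsFactorised A B H)
    (hc : (Nat.card A).Coprime (Nat.card B)) (hK : K ≤ H) (hN : H ≤ normalizer (K : Set G)) :
    IsFactorised A B K := by
  intro k hk
  obtain ⟨a, ha, b, hb, ha', hb', rfl⟩ := h k (hK hk)
  have key : ∀ j : ℕ, a ^ j * b ^ j ∈ K := by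
    intro j
    induction j with
    | zero => simp
    | succ j ih =>
      have h1 := conj_mem_of_le_normalizer hN (H.pow_mem ha' j) hk
      have h2 : a ^ (j + 1) * b ^ (j + 1) = (a ^ j * (a * b) * (a ^ j)⁻¹) * (a ^ j * b ^ j) := by
        rw [pow_succ a, pow_succ' b]; group
      rw [h2]
      exact K.mul_mem h1 ih
  have hbB : b ^ Nat.card B = 1 := pow_card_of_mem hb
  have haA : a ^ Nat.card A = 1 := pow_card_of_mem ha
  have haK : a ∈ K := mem_of_pow_mem_of_coprime hc (by rw [haA]; exact K.one_mem)
    (by simpa [hbB] using key (Nat.card B))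
  exact ⟨a, ha, b, hb, haK, by simpa using K.mul_mem (K.inv_mem haK) hk, rfl⟩

theorem eq_one_of_mem_isPGroup [Finite G] {p : ℕ} (hp : p.Prime) {K B : Subgroup G}
    (hK : IsPGroup p K)
    (hB : ¬ p ∣ Nat.card B) {b : G} (hbK : b ∈ K) (hb : b ∈ B) : b = 1 := by
  have hbB : b ^ Nat.card B = 1 := pow_card_of_mem hb
  obtain ⟨k, hk⟩ := hK ⟨b, hbK⟩
  have hk' : b ^ p ^ k = 1 := by simpa [Subtype.ext_iff] using hk
  have := mem_of_pow_mem_of_coprime (K := (⊥ : Subgroup G)) (a := b) (m := p ^ k) (n := Nat.card B)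
    (Nat.Coprime.pow_left k (hp.coprime_iff_not_dvd.2 hB)) (by simpa using hk') (by simpa using hbB)
  simpa using this

end

/-- A factorisation `G = AB` with coprime nilpotent factors of a nonabelian group, neither of them
of prime power order, in which all proper factorised subgroups are solvable. -/
structure MinimalFactorisation {G : Type*} [Group G] (A B : Subgroup G) : Prop where
  not_comm : ¬ ∀ x y : G, x * y = y * x
  left : Group.IsNilpotent A
  right : Group.IsNilpotent B
  coprime : (Nat.card A).Coprime (Nat.card B)
  exists_mul : ∀ g : G, ∃ a ∈ A, ∃ b ∈ B, g = a * b
  solvable : ∀ H : Subgroup G, H ≠ ⊤ → IsFactorised A B H → Group.IsSolvable H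
  left_ne : ∀ p : ℕ, p.Prime → primesPart {p}ᶜ A ≠ ⊥
  right_ne : ∀ p : ℕ, p.Prime → primesPart {p}ᶜ B ≠ ⊥

namespace MinimalFactorisation

variable {G : Type*} [Group G] {A B : Subgroup G}

theorem symm (h : MinimalFactorisation A B) : MinimalFactorisation B A where
  not_comm := h.not_comm
  left := h.right
  right := h.left
  coprime := h.coprime.symm
  exists_mul g := by
    obtain ⟨a, ha, b, hb, hab⟩ := h.exists_mul g⁻¹
    refine ⟨b⁻¹, B.inv_mem hb, a⁻¹, A.inv_mem ha, ?_⟩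
    rw [← mul_inv_rev, ← hab, inv_inv]
  solvable H hH hf := h.solvable H hH hf.symm
  left_ne := h.right_ne
  right_ne := h.left_ne

theorem isFactorised_of_le (h : MinimalFactorisation A B) {H : Subgroup G} (hA : A ≤ H) :
    IsFactorised A B H := by
  intro x hx
  obtain ⟨a, ha, b, hb, rfl⟩ := h.exists_mul x
  exact ⟨a, ha, b, hb, hA ha, by simpa using H.mul_mem (H.inv_mem (hA ha)) hx, rfl⟩

theorem le_left_of_isPGroup [Finite G] {H K : Subgroup G} (h : MinimalFactorisation A B)
    (hf : IsFactorised A B H) (hK : K ≤ H) (hN : H ≤ normalizer (K : Set G)) {t : ℕ}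
    (ht : t.Prime) (hKt : IsPGroup t K) (htB : ¬ t ∣ Nat.card B) : K ≤ A := by
  intro k hk
  obtain ⟨a, ha, b, hb, ha', hb', rfl⟩ := hf.of_le_normalizer h.coprime hK hN k hk
  rw [eq_one_of_mem_isPGroup ht hKt htB hb' hb, mul_one]
  exact ha

theorem ne_bot (h : MinimalFactorisation A B) : A ≠ ⊥ := by
  rintro rfl
  exact h.left_ne 2 Nat.prime_two (le_bot_iff.1 (primesPart_le _ _))

theorem ne_top [Finite G] (h : MinimalFactorisation A B) : A ≠ ⊤ := by
  rintro rfl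
  have h1 : Nat.card B ∣ Nat.card (⊤ : Subgroup G) := by
    rw [card_top]; exact card_subgroup_dvd_card B
  exact h.symm.ne_bot (card_eq_one.1 (Nat.eq_one_of_dvd_coprimes h.coprime.symm dvd_rfl h1))

theorem not_dvd_right (h : MinimalFactorisation A B) {p : ℕ} (hp : p.Prime)
    (hpA : p ∣ Nat.card A) : ¬ p ∣ Nat.card B := fun hB =>
  Nat.not_coprime_of_dvd_of_dvd hp.one_lt hpA hB h.coprime

theorem not_dvd_left (h : MinimalFactorisation A B) {p : ℕ} (hp : p.Prime)
    (hpB : p ∣ Nat.card B) : ¬ p ∣ Nat.card A := h.symm.not_dvd_right hp hpB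

variable [IsSimpleGroup G]

theorem eq_bot_of_le (h : MinimalFactorisation A B) {X T : Subgroup G} (hX : X ≤ T)
    (hA : A ≤ normalizer (X : Set G)) (hB : B ≤ T) (hT : T ≠ ⊤) : X = ⊥ := by
  have key : normalClosure (X : Set G) ≤ T := by
    rw [normalClosure, closure_le]
    intro y hy
    obtain ⟨x, hx, hxy⟩ := Group.mem_conjugatesOfSet_iff.1 hy
    obtain ⟨g, rfl⟩ := isConj_iff.1 hxy
    obtain ⟨b, hb, a, ha, rfl⟩ := h.symm.exists_mul g
    have h1 := T.mul_mem (T.mul_mem (hB hb) (hX (conj_mem_of_le_normalizer hA ha hx)))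
      (T.inv_mem (hB hb))
    have h2 : b * a * x * (b * a)⁻¹ = b * (a * x * a⁻¹) * b⁻¹ := by group
    rw [h2]
    exact h1
  rcases (normalClosure_normal (s := (X : Set G))).eq_bot_or_eq_top with h1 | h1
  · rw [← le_bot_iff, ← h1]
    exact subset_normalClosure
  · exact absurd (top_le_iff.1 (h1 ▸ key)) hT

theorem not_commute_central (h : MinimalFactorisation A B) {z w : G} (hz1 : z ≠ 1)
    (hz : ∀ a ∈ A, a * z = z * a) (hw1 : w ≠ 1) (hwB : ∀ b ∈ B, b * w = w * b) :
    z * w ≠ w * z := by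
  intro hzw
  have h1 := h.symm.eq_bot_of_le (X := zpowers w) (T := centralizer {z}) ?_ ?_ ?_
    (centralizer_ne_top_of_ne_one h.not_comm hz1)
  · exact hw1 (zpowers_eq_bot.1 h1)
  · rw [zpowers_le, mem_centralizer_singleton_iff]
    exact hzw.symm
  · intro b hb
    rw [mem_normalizer_iff]
    intro x
    have : ∀ i : ℤ, b * w ^ i * b⁻¹ = w ^ i := fun i => by
      rw [← conj_zpow, hwB b hb]; simp
    constructor
    · rintro ⟨i, rfl⟩
      exact ⟨i, (this i).symm⟩
    · rintro ⟨i, hi⟩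
      refine ⟨i, ?_⟩
      have h2 := this i
      simp only at hi
      have h3 : b * w ^ i * b⁻¹ = b * x * b⁻¹ := by rw [h2, hi]
      simpa using h3
  · intro a ha
    exact mem_centralizer_singleton_iff.2 (hz a ha)

end MinimalFactorisation

end

section

open Subgroup

section
variable {G : Type*} [Group G]

theorem exists_central_mem_of_le_normalizer [Finite G] {p : ℕ} (hp : p.Prime) {P N : Subgroup G}
    (hP : IsPGroup p P) (hNP : N ≤ P) (hN : P ≤ normalizer (N : Set G)) (h0 : N ≠ ⊥) :
    ∃ z ∈ N, z ≠ 1 ∧ ∀ a ∈ P, a * z = z * a := by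
  have := Fact.mk hp
  have hn : (N.subgroupOf P).Normal := (normal_subgroupOf_iff_le_normalizer hNP).2 hN
  have hcp : IsPGroup p (ConjAct P) := hP.of_equiv ConjAct.toConjAct
  have hdvd : p ∣ Nat.card (N.subgroupOf P) := by
    have h1 : IsPGroup p (N.subgroupOf P) := hP.to_subgroup _
    have h2 : Nontrivial (N.subgroupOf P) := by
      rw [nontrivial_iff_ne_bot]
      intro h
      exact h0 (by rw [subgroupOf_eq_bot, disjoint_iff, inf_eq_left.2 hNP] at h; exact h)
    obtain ⟨n, hn, h3⟩ := h1.nontrivial_iff_card.1 h2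
    rw [h3]
    exact dvd_pow_self p hn.ne'
  obtain ⟨b, hb, hb1⟩ := hcp.exists_fixed_point_of_prime_dvd_card_of_fixed_point (N.subgroupOf P)
    hdvd
    (a := 1) (fun g => smul_one g)
  refine ⟨b, mem_subgroupOf.1 b.2, ?_, fun a ha => ?_⟩
  · intro h
    exact hb1 (Subtype.ext (Subtype.ext h.symm))
  · have h1 := hb (ConjAct.toConjAct ⟨a, ha⟩)
    have h2 : a * (b : P) * a⁻¹ = (b : P) := congrArg (fun x : N.subgroupOf P => ((x : P) : G)) h1
    exact mul_inv_eq_iff_eq_mul.1 h2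

theorem exists_prime_ne_of_primesPart_compl_ne_bot [Finite G] {A : Subgroup G} [Group.IsNilpotent A]
    {p : ℕ} (h : primesPart {p}ᶜ A ≠ ⊥) :
    ∃ r : ℕ, r.Prime ∧ r ≠ p ∧ primesPart {r} A ≠ ⊥ ∧ primesPart {r} A ≤ primesPart {p}ᶜ A := by
  obtain ⟨r, hr, hd⟩ := exists_prime_dvd_of_ne_bot h
  have hrp : r ≠ p := by simpa using prime_mem_of_dvd_card_primesPart hr hd
  exact ⟨r, hr, hrp, primesPart_singleton_ne_bot hr (hd.trans (card_dvd_of_le (primesPart_le _ _))),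
    primesPart_mono (by simpa using hrp.symm) A⟩

theorem exists_card_eq_mul_of_coprime_index [Finite G] {X L : Subgroup G} (hX : X ≤ L)
    (hc : (Nat.card X).Coprime X.index) :
    ∃ m, Nat.card L = Nat.card X * m ∧ (Nat.card X).Coprime m :=
  ⟨X.relIndex L, by rw [← Nat.card_congr (subgroupOfEquivOfLe hX).toEquiv, relIndex,
    card_mul_index],
    hc.coprime_dvd_right (relIndex_dvd_index_of_le hX)⟩

theorem mem_normalizer_of_conj_mem [Finite G] {K : Subgroup G} {x : G}
    (h : ∀ k ∈ K, x * k * x⁻¹ ∈ K) : x ∈ normalizer (K : Set G) := by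
  have h1 : K.map (MulAut.conj x).toMonoidHom = K := by
    refine eq_of_le_of_card_ge ?_ (card_map_conj K x).ge
    rintro _ ⟨k, hk, rfl⟩
    exact h k hk
  rw [mem_normalizer_iff]
  refine fun k => ⟨h k, fun hk => ?_⟩
  have := mem_map_conj.1 (h1.symm ▸ hk : x * k * x⁻¹ ∈ K.map (MulAut.conj x).toMonoidHom)
  simpa [mul_assoc] using this

theorem mem_normalizer_of_commute {K : Subgroup G} {x : G}
    (h : ∀ k ∈ K, x * k = k * x) : x ∈ normalizer (K : Set G) :=
  centralizer_le_normalizer (K : Set G) (mem_centralizer_iff.2 fun k hk => (h k hk).symm)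
theorem card_eq_mul_of_forall_exists_mul {A B : Subgroup G}
    (hc : (Nat.card A).Coprime (Nat.card B)) (hAB : ∀ g : G, ∃ a ∈ A, ∃ b ∈ B, g = a * b) :
    Nat.card G = Nat.card A * Nat.card B := by
  have h1 : IsComplement' A B := isComplement'_of_disjoint_and_mul_eq_univ
    (disjoint_of_coprime_natCard hc) (by
      rw [Set.eq_univ_iff_forall]
      intro g
      obtain ⟨a, ha, b, hb, rfl⟩ := hAB g
      exact Set.mul_mem_mul ha hb)
  exact h1.card_mul_card.symm

end

namespace MinimalFactorisation

variable {G : Type*} [Group G] {A B : Subgroup G}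

theorem card_eq (h : MinimalFactorisation A B) : Nat.card G = Nat.card A * Nat.card B :=
  card_eq_mul_of_forall_exists_mul h.coprime h.exists_mul

variable [Finite G]

theorem index_eq (h : MinimalFactorisation A B) : A.index = Nat.card B :=
  Nat.eq_of_mul_eq_mul_left Nat.card_pos (A.card_mul_index.trans h.card_eq)

theorem coprime_index (h : MinimalFactorisation A B) (π : Set ℕ) :
    (Nat.card (primesPart π A)).Coprime (primesPart π A).index := by
  have := h.left
  have h1 : Nat.card (primesPart π A) * (primesPart π A).index =
      Nat.card (primesPart π A) * (Nat.card (primesPart πᶜ A) * Nat.card B) := by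
    rw [card_mul_index, h.card_eq, ← mul_assoc, card_primesPart_mul]
  rw [Nat.eq_of_mul_eq_mul_left Nat.card_pos h1]
  refine Nat.Coprime.mul_right (Nat.coprime_of_dvd fun p hp h2 h3 => ?_)
    (h.coprime.coprime_dvd_left (card_dvd_of_le (primesPart_le _ _)))
  exact prime_mem_of_dvd_card_primesPart hp h3 (prime_mem_of_dvd_card_primesPart hp h2)

theorem not_dvd_index (h : MinimalFactorisation A B) {p : ℕ} (hp : p.Prime) (hA : p ∣ Nat.card A) :
    ¬ p ∣ (primesPart {p} A).index := by
  have := h.left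
  intro h1
  have h2 := primesPart_singleton_ne_bot hp hA
  obtain ⟨q, hq, h3⟩ := exists_prime_dvd_of_ne_bot h2
  obtain rfl : q = p := by simpa using prime_mem_of_dvd_card_primesPart hq h3
  exact Nat.not_coprime_of_dvd_of_dvd hq.one_lt h3 h1 (h.coprime_index {q})

/-- A `p`-subgroup has a conjugate in the Sylow `p`-subgroup of the factor whose order is
divisible by `p`, by an element of the other factor. -/
theorem exists_conj_mem_primesPart (h : MinimalFactorisation A B) {p : ℕ} (hp : p.Prime)
    (hA : ¬ p ∣ Nat.card B) {P : Subgroup G} (hP : IsPGroup p P) :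
    ∃ b ∈ B, ∀ x ∈ P, b * x * b⁻¹ ∈ primesPart {p} A := by
  have := h.left
  have hidx : ¬ p ∣ (primesPart {p} A).index := by
    by_cases hpA : p ∣ Nat.card A
    · exact h.not_dvd_index hp hpA
    · intro h1
      have h2 : p ∣ Nat.card G := h1.trans (index_dvd_card _)
      rw [h.card_eq, hp.dvd_mul] at h2
      exact h2.elim hpA hA
  obtain ⟨g, -, hg⟩ := exists_conj_le_of_isPGroup hp (L := ⊤) (Q := primesPart {p} A) le_top le_top
    hP
    (isPGroup_primesPart hp) (by rw [card_top, card_mul_index]) hidx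
  obtain ⟨a, ha, b, hb, rfl⟩ := h.exists_mul g
  refine ⟨b, hb, fun x hx => ?_⟩
  have h1 := conj_mem_primesPart (A := A) (g := a⁻¹)
    (fun y hy => A.mul_mem (A.mul_mem (A.inv_mem ha) hy)
    (A.inv_mem (A.inv_mem ha))) (hg x hx)
  have h2 : a⁻¹ * (a * b * x * (a * b)⁻¹) * a⁻¹⁻¹ = b * x * b⁻¹ := by group
  rwa [h2] at h1

theorem le_normalizer_primesPart (π : Set ℕ) : A ≤ normalizer (primesPart π A : Set G) :=
  le_normalizer.trans (normalizer_le_normalizer_primesPart π A)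

variable [IsSimpleGroup G]

theorem eq_bot_of_le_normalizer (h : MinimalFactorisation A B) {M K : Subgroup G}
    (hA : A ≤ M) (hK : K ≤ M) (hN : M ≤ normalizer (K : Set G)) {t : ℕ} (ht : t.Prime)
    (hKt : IsPGroup t K) (htA : ¬ t ∣ Nat.card A) : K = ⊥ :=
  h.eq_bot_of_le (h.symm.le_left_of_isPGroup (h.isFactorised_of_le hA).symm hK hN ht hKt htA)
    (hA.trans hN) le_rfl h.symm.ne_top

theorem primesPart_inf_centralizer_ne_bot (h : MinimalFactorisation A B) {q r : ℕ}
    (hr : r.Prime) (hq : q.Prime) {E : Subgroup G} (hE : E ≤ primesPart {q} B)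
    (hrA : primesPart {r} A ≠ ⊥)
    (hN : primesPart {r} A ≤ normalizer (E : Set G)) :
    primesPart {r} A ⊓ centralizer (E : Set G) ≠ ⊥ := by
  intro hbot
  have := h.left
  have := h.right
  set P := primesPart {r} A
  set D := primesPart {q}ᶜ B
  set L := normalizer (E : Set G) with hL
  have hDC : D ≤ centralizer (E : Set G) := fun x hx => mem_centralizer_iff.2 fun e he =>
    commute_of_mem_primesPart disjoint_compl_right (hE he) hx
  have hBT : B ≤ normalizer (D : Set G) := le_normalizer_primesPart _
  have hT : normalizer (D : Set G) ≠ ⊤ := normalizer_ne_top_of_ne (h.right_ne q hq)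
    fun hD => h.symm.ne_top (top_le_iff.1 (hD ▸ primesPart_le _ _))
  have hfr : ∀ l ∈ L, ∃ c ∈ centralizer (E : Set G), c * l ∈ normalizer (D : Set G) := by
    intro l hl
    obtain ⟨m, hm, hcop⟩ := exists_card_eq_mul_of_coprime_index hDC (h.symm.coprime_index {q}ᶜ)
    have hDn : Group.IsNilpotent D := isNilpotent_primesPart
    obtain ⟨c, hc, hc'⟩ := exists_conj_of_isNilpotent_hall (R₁ := D.map (MulAut.conj l).toMonoidHom)
      (R₂ := D) (by
        rintro _ ⟨x, hx, rfl⟩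
        exact conj_mem_of_le_normalizer (normalizer_le_normalizer_centralizer E) hl (hDC hx)) hDC
      (isNilpotent_map_conj hDn l) hDn (card_map_conj _ _) hm hcop
    refine ⟨c, hc, mem_normalizer_of_conj_mem fun k hk => ?_⟩
    have := hc' (l * k * l⁻¹) ⟨k, hk, rfl⟩
    have h2 : c * l * k * (c * l)⁻¹ = c * (l * k * l⁻¹) * c⁻¹ := by group
    rwa [h2]
  have hcard : Nat.card P ∣ Nat.card (normalizer (D : Set G)) := by
    let φ := E.normalizerMonoidHom
    have hker : ∀ x : L, φ x = 1 ↔ (x : G) ∈ centralizer (E : Set G) := fun x => by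
      rw [← MonoidHom.mem_ker, normalizerMonoidHom_ker, mem_subgroupOf]
    have h1 : Nat.card P = Nat.card ((P.subgroupOf L).map φ) := by
      rw [← Nat.card_congr (subgroupOfEquivOfLe hN).toEquiv]
      refine Nat.card_congr (Equiv.ofBijective (φ.subgroupMap _) ⟨?_, φ.subgroupMap_surjective _⟩)
      rw [injective_iff_map_eq_one]
      intro x hx
      have h2 : φ x = 1 := congrArg Subtype.val hx
      have h3 : ((x : L) : G) ∈ P ⊓ centralizer (E : Set G) := ⟨mem_subgroupOf.1 x.2, (hker _).1 h2⟩
      rw [hbot, mem_bot] at h3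
      exact Subtype.ext (Subtype.ext h3)
    have h2 : (P.subgroupOf L).map φ ≤ ((normalizer (D : Set G)).subgroupOf L).map φ := by
      rintro _ ⟨x, -, rfl⟩
      obtain ⟨c, hc, hcx⟩ := hfr x x.2
      have hcL : c ∈ L := centralizer_le_normalizer _ hc
      refine ⟨⟨c, hcL⟩ * x, mem_subgroupOf.2 hcx, ?_⟩
      rw [map_mul, (hker ⟨c, hcL⟩).2 hc, one_mul]
    rw [h1]
    refine (card_dvd_of_le h2).trans ((card_dvd_of_surjective _ (φ.subgroupMap_surjective _)).trans
      ?_)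
    rw [← card_map_of_injective L.subtype_injective, subgroupOf_map_subtype]
    exact card_dvd_of_le inf_le_left
  have := Fact.mk hr
  have hrA' : r ∣ Nat.card A := dvd_card_of_primesPart_ne_bot hr hrA
  obtain ⟨k, hk⟩ := (isPGroup_primesPart (A := A) hr).exists_card_eq
  rw [hk] at hcard
  obtain ⟨Q, hQ⟩ := Sylow.exists_subgroup_card_pow_prime r hcard
  have hQc : Nat.card (Q.map (normalizer (D : Set G)).subtype) = r ^ k := by
    rw [card_map_of_injective (subtype_injective _), hQ]
  have hnd : ¬ r ∣ P.index := h.not_dvd_index hr hrA'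
  have hG : Nat.card (⊤ : Subgroup G) = r ^ k * P.index := by rw [card_top, ← hk, card_mul_index]
  obtain ⟨g, -, hg⟩ := exists_conj_le_of_isPGroup hr (L := ⊤) (P := P)
    (Q := Q.map (normalizer (D : Set G)).subtype) le_top le_top
    (isPGroup_primesPart hr) (IsPGroup.of_card hQc) (by rw [hQc, hG]) hnd
  obtain ⟨b, hb, a, ha, rfl⟩ := h.symm.exists_mul g
  refine hrA (h.eq_bot_of_le (X := P) (T := normalizer (D : Set G)) (fun x hx => ?_)
    (le_normalizer_primesPart _) hBT hT)
  have h1 : a⁻¹ * x * a⁻¹⁻¹ ∈ P :=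
    conj_mem_of_le_normalizer (le_normalizer_primesPart _) (A.inv_mem ha) hx
  have h2 := map_subtype_le _ (hg _ h1)
  have h3 : b * a * (a⁻¹ * x * a⁻¹⁻¹) * (b * a)⁻¹ = b * x * b⁻¹ := by group
  rw [h3] at h2
  have hb' := hBT hb
  have h4 := mul_mem (mul_mem (inv_mem hb') h2) hb'
  have h5 : b⁻¹ * (b * x * b⁻¹) * b = x := by group
  rwa [h5] at h4

end MinimalFactorisation

end

section

open Subgroup

section
variable {G : Type*} [Group G]

theorem le_normalizer_centralizer_singleton {A : Subgroup G} {z : G} (hz : ∀ a ∈ A, a * z = z * a) :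
    A ≤ centralizer {z} := fun a ha => mem_centralizer_singleton_iff.2 (hz a ha)

theorem exists_core [Finite G] (A M : Subgroup G) : ∃ F ≤ A, M ≤ normalizer (F : Set G) ∧
    ∀ K ≤ A, M ≤ normalizer (K : Set G) → K ≤ F := by
  have hmem : ∀ x, x ∈ (⨅ m : M, A.comap (MulAut.conj (m : G)).toMonoidHom) ↔
      ∀ m ∈ M, m * x * m⁻¹ ∈ A := fun x => by simp [mem_iInf]
  refine ⟨⨅ m : M, A.comap (MulAut.conj (m : G)).toMonoidHom, fun x hx => ?_,
    le_normalizer_of_conj fun x hx k hk => ?_, fun K hK hN k hk => ?_⟩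
  · simpa using (hmem x).1 hx 1 M.one_mem
  · rw [hmem] at hk ⊢
    intro m hm
    have := hk (m * x) (M.mul_mem hm hx)
    have h2 : m * (x * k * x⁻¹) * m⁻¹ = m * x * k * (m * x)⁻¹ := by group
    rwa [h2]
  · rw [hmem]
    exact fun m hm => hK (conj_mem_of_le_normalizer hN hm hk)

theorem isNilpotent_of_commute {C : Subgroup G} (h : ∀ a ∈ C, ∀ b ∈ C, a * b = b * a) :
    Group.IsNilpotent C :=
  isNilpotent_of_commutator_commute fun x hx y hy => h x (commutator_le_self C hx) y hy
end

namespace MinimalFactorisation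

variable {G : Type*} [Group G] [Finite G] {A B : Subgroup G} [IsSimpleGroup G]

theorem commute_of_le_primesPart (h : MinimalFactorisation A B) {q r : ℕ}
    (hr : r.Prime) (hq : q.Prime) (hqA : ¬ q ∣ Nat.card A) {E : Subgroup G}
    (hE : E ≤ primesPart {q} B) (hrA : primesPart {r} A ≠ ⊥)
    (hN : primesPart {r} A ≤ normalizer (E : Set G)) {y : G} (hy : y ∈ primesPart {r} A)
    (hyA : ∀ a ∈ A, a * y = y * a) : ∀ e ∈ E, e * y = y * e := by
  have := h.left
  have := h.right
  have hNC := le_normalizer_inf (le_normalizer (H := primesPart {r} A))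
    (hN.trans (normalizer_le_normalizer_centralizer E))
  obtain ⟨z, hz, hz1, hzP⟩ := exists_central_mem_of_le_normalizer hr
    (isPGroup_primesPart (A := A) hr) inf_le_left hNC
    (h.primesPart_inf_centralizer_ne_bot hr hq hE hrA hN)
  have hzA : ∀ a ∈ A, a * z = z * a := by
    intro a ha
    obtain ⟨u, hu, v, hv, rfl⟩ := exists_mul_of_mem {r} ha
    rw [mul_assoc, ← commute_of_mem_primesPart disjoint_compl_right hz.1 hv, ← mul_assoc, hzP u hu,
      mul_assoc]
  have hAM := le_normalizer_centralizer_singleton hzA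
  have hMt := centralizer_ne_top_of_ne_one h.not_comm hz1
  have hMf := h.isFactorised_of_le hAM
  obtain ⟨C, hCM, hCN, hCc, hyC⟩ := exists_commutative_normal_of_commute
    (h.solvable _ hMt hMf) (hAM (primesPart_le _ _ hy)) (by
      intro K hK hKN t ht hKt k hk
      by_cases htB : t ∣ Nat.card B
      · rw [h.eq_bot_of_le_normalizer hAM hK hKN ht hKt (h.not_dvd_left ht htB), mem_bot] at hk
        simp [hk]
      · exact (hyA k (h.le_left_of_isPGroup hMf hK hKN ht hKt htB hk)).symm)
  intro e he
  have := isNilpotent_of_commute hCc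
  have heM : e ∈ centralizer ({z} : Set G) :=
    mem_centralizer_singleton_iff.2 (mem_centralizer_iff.1 hz.2 e he)
  have hc : e * y * e⁻¹ * y⁻¹ ∈ C :=
    C.mul_mem (conj_mem_of_le_normalizer hCN heM hyC) (C.inv_mem hyC)
  have hc' : e * y * e⁻¹ * y⁻¹ ∈ E := by
    have h1 := E.mul_mem he (conj_mem_of_le_normalizer hN hy (E.inv_mem he))
    have h2 : e * (y * e⁻¹ * y⁻¹) = e * y * e⁻¹ * y⁻¹ := by group
    rwa [h2] at h1
  have hbot := h.eq_bot_of_le_normalizer hAM ((primesPart_le {q} C).trans hCM)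
    (hCN.trans (normalizer_le_normalizer_primesPart _ C)) hq (isPGroup_primesPart hq) hqA
  have h3 : e * y * e⁻¹ * y⁻¹ ∈ primesPart {q} C :=
    mem_primesPart_of hc (mem_primesPart_iff.1 (hE hc')).2
  rw [hbot, mem_bot, mul_inv_eq_one, mul_inv_eq_iff_eq_mul] at h3
  exact h3

theorem commute_of_isPGroup (h : MinimalFactorisation A B) {q r : ℕ}
    (hr : r.Prime) (hq : q.Prime) (hqA : ¬ q ∣ Nat.card A) {E : Subgroup G}
    (hE : IsPGroup q E) (hrA : primesPart {r} A ≠ ⊥)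
    (hN : primesPart {r} A ≤ normalizer (E : Set G)) {y : G} (hy : y ∈ primesPart {r} A)
    (hyA : ∀ a ∈ A, a * y = y * a) : ∀ e ∈ E, e * y = y * e := by
  have := h.left
  obtain ⟨a, ha, haE⟩ := h.symm.exists_conj_mem_primesPart hq hqA hE
  intro e he
  have hE' : E.map (MulAut.conj a).toMonoidHom ≤ primesPart {q} B := by
    rintro _ ⟨x, hx, rfl⟩
    exact haE x hx
  have hN' : primesPart {r} A ≤ normalizer (E.map (MulAut.conj a).toMonoidHom : Set G) := by
    refine le_normalizer_of_conj fun u hu k hk => ?_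
    rw [mem_map_conj] at hk ⊢
    have hu' : a⁻¹ * u * a⁻¹⁻¹ ∈ primesPart {r} A :=
      conj_mem_of_le_normalizer (le_normalizer_primesPart _) (A.inv_mem ha) hu
    have h1 := conj_mem_of_le_normalizer hN hu' hk
    have h2 : a⁻¹ * u * a⁻¹⁻¹ * (a⁻¹ * k * a) * (a⁻¹ * u * a⁻¹⁻¹)⁻¹ = a⁻¹ * (u * k * u⁻¹) * a := by
      group
    rwa [h2] at h1
  have h1 := h.commute_of_le_primesPart hr hq hqA hE' hrA hN' hy hyA _ ⟨e, he, rfl⟩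
  have h2 : a * e * a⁻¹ * y = y * (a * e * a⁻¹) := h1
  have h3 : a⁻¹ * y = y * a⁻¹ := hyA _ (A.inv_mem ha)
  have h4 : a * (e * y) * a⁻¹ = a * (y * e) * a⁻¹ := by
    calc a * (e * y) * a⁻¹ = a * e * (y * a⁻¹) := by group
      _ = a * e * a⁻¹ * y := by rw [← h3]; group
      _ = y * a * (e * a⁻¹) := by rw [h2]; group
      _ = a * (y * e) * a⁻¹ := by rw [← hyA a ha]; group
  simpa using h4

theorem exists_commutative_normal (h : MinimalFactorisation A B) {H : Subgroup G} (hH : H ≠ ⊤)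
    (hf : IsFactorised A B H) {r : ℕ} (hr : r.Prime) (hrA : primesPart {r} A ≠ ⊥)
    (hrH : primesPart {r} A ≤ H) {z : G} (hz : z ∈ primesPart {r} A) (hzA : ∀ a ∈ A,
    a * z = z * a) :
    ∃ C ≤ H, H ≤ normalizer (C : Set G) ∧ (∀ a ∈ C, ∀ b ∈ C, a * b = b * a) ∧ z ∈ C := by
  refine exists_commutative_normal_of_commute (h.solvable H hH hf) (hrH hz) ?_
  intro K hK hN t ht hKt k hk
  by_cases htB : t ∣ Nat.card B
  · exact (h.commute_of_isPGroup hr ht (h.not_dvd_left ht htB) hKt hrA (hrH.trans hN) hz hzA k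
      hk).symm
  · exact (hzA k (h.le_left_of_isPGroup hf hK hN ht hKt htB hk)).symm

theorem primesPart_inf_centralizer_eq_bot (h : MinimalFactorisation A B) {p q : ℕ} (hp : p.Prime)
    (hq : q.Prime) : primesPart {q} B ⊓ centralizer (primesPart {p}ᶜ A : Set G) = ⊥ := by
  by_contra hD
  have := h.left
  have := h.right
  set D := primesPart {q} B ⊓ centralizer (primesPart {p}ᶜ A : Set G) with hDdef
  have hDB : D ≤ B := inf_le_left.trans (primesPart_le _ _)
  have hH : normalizer (D : Set G) ≠ ⊤ := normalizer_ne_top_of_ne hD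
    fun hDt => h.symm.ne_top (top_le_iff.1 (hDt ▸ hDB))
  have hf : IsFactorised A B (normalizer (D : Set G)) := by
    intro x hx
    obtain ⟨a, ha, b, hb, rfl⟩ := h.exists_mul x
    have hbD : b ∈ normalizer (D : Set G) := by
      refine mem_normalizer_of_conj_mem fun k hk => ⟨?_, ?_⟩
      · exact conj_mem_of_le_normalizer (le_normalizer_primesPart _) hb hk.1
      · have h1 := ((mem_normalizer_iff.1 hx k).1 hk).2
        have h2 := conj_mem_of_le_normalizer ((le_normalizer_primesPart {p}ᶜ).trans
          (normalizer_le_normalizer_centralizer _)) (A.inv_mem ha) h1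
        have h3 : a⁻¹ * (a * b * k * (a * b)⁻¹) * a⁻¹⁻¹ = b * k * b⁻¹ := by group
        rwa [h3] at h2
    exact ⟨a, ha, b, hb, by simpa using mul_mem hx (inv_mem hbD), hbD, rfl⟩
  obtain ⟨r, hr, -, hrA, hrp⟩ := exists_prime_ne_of_primesPart_compl_ne_bot (h.left_ne p hp)
  obtain ⟨s, hs, -, hsB, hsq⟩ := exists_prime_ne_of_primesPart_compl_ne_bot (h.right_ne q hq)
  have hrH : primesPart {r} A ≤ normalizer (D : Set G) := fun x hx =>
    mem_normalizer_of_commute fun k hk => mem_centralizer_iff.1 hk.2 x (hrp hx)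
  have hsH : primesPart {s} B ≤ normalizer (D : Set G) := fun x hx =>
    mem_normalizer_of_commute fun k hk =>
      (commute_of_mem_primesPart disjoint_compl_right hk.1 (hsq hx)).symm
  obtain ⟨z, hz, hz1, hzA⟩ := exists_central_of_primesPart_ne_bot hrA
  obtain ⟨w, hw, hw1, hwB⟩ := exists_central_of_primesPart_ne_bot hsB
  obtain ⟨C, hCH, hCN, hCc, hzC⟩ := h.exists_commutative_normal hH hf hr hrA hrH hz hzA
  have := isNilpotent_of_commute hCc
  have hzR : z ∈ primesPart {r} C := mem_primesPart_of hzC (mem_primesPart_iff.1 hz).2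
  refine h.not_commute_central hz1 hzA hw1 hwB (h.symm.commute_of_isPGroup hs hr
    (h.not_dvd_right hr (dvd_card_of_primesPart_ne_bot hr hrA)) (isPGroup_primesPart (A := C) hr)
    hsB
    (hsH.trans (hCN.trans (normalizer_le_normalizer_primesPart _ C))) hw hwB z hzR)

theorem eq_one_of_mem_centralizer (h : MinimalFactorisation A B) {p : ℕ} (hp : p.Prime) {b : G}
    (hb : b ∈ B) (hbA : b ∈ centralizer (primesPart {p}ᶜ A : Set G)) : b = 1 := by
  have := h.right
  have := isNilpotent_of_le (inf_le_left : B ⊓ centralizer (primesPart {p}ᶜ A : Set G) ≤ B)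
  have h1 : B ⊓ centralizer (primesPart {p}ᶜ A : Set G) ≤ ⊥ := by
    refine le_of_primesPart_le fun q hq x hx => ?_
    rw [← h.primesPart_inf_centralizer_eq_bot hp hq]
    rw [mem_primesPart_iff] at hx
    exact ⟨mem_primesPart_of hx.1.1 hx.2, hx.1.2⟩
  exact mem_bot.1 (h1 ⟨hb, hbA⟩)

theorem normalizer_primesPart_compl_le (h : MinimalFactorisation A B) {p : ℕ} (hp : p.Prime) :
    normalizer (primesPart {p}ᶜ A : Set G) ≤ normalizer (A : Set G) := by
  have := h.left
  have hCN := normalizer_le_normalizer_centralizer (primesPart {p}ᶜ A)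
  have hf := (h.isFactorised_of_le (le_normalizer_primesPart {p}ᶜ)).of_le_normalizer h.coprime
    (centralizer_le_normalizer _) hCN
  intro x hx
  refine mem_normalizer_of_conj_mem fun k hk => ?_
  obtain ⟨y, hy, z, hz, rfl⟩ := exists_mul_of_mem {p} hk
  have h1 := conj_mem_of_le_normalizer le_rfl hx hz
  have h2 := conj_mem_of_le_normalizer hCN hx (k := y) (mem_centralizer_iff.2 fun v hv =>
    (commute_of_mem_primesPart disjoint_compl_right hy hv).symm)
  obtain ⟨a, ha, b, hb, -, hbC, hab⟩ := hf _ h2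
  rw [h.eq_one_of_mem_centralizer hp hb hbC, mul_one] at hab
  have h3 : x * (y * z) * x⁻¹ = (x * y * x⁻¹) * (x * z * x⁻¹) := by group
  rw [h3, hab]
  exact A.mul_mem ha (primesPart_le _ _ h1)

theorem mem_of_commute_core (h : MinimalFactorisation A B) {M F : Subgroup G} (hAM : A ≤ M)
    (hM : M ≠ ⊤) (hF : ∀ K ≤ A, M ≤ normalizer (K : Set G) → K ≤ F) {x : G} (hx : x ∈ M)
    (hxF : ∀ f ∈ F, x * f = f * x) : x ∈ F := by
  have hf := h.isFactorised_of_le hAM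
  obtain ⟨C, hCM, hCN, hCc, hxC⟩ := exists_commutative_normal_of_commute
    (h.solvable _ hM hf) hx (by
      intro K hK hKN t ht hKt k hk
      by_cases htB : t ∣ Nat.card B
      · rw [h.eq_bot_of_le_normalizer hAM hK hKN ht hKt (h.not_dvd_left ht htB), mem_bot] at hk
        simp [hk]
      · exact hxF k (hF K (h.le_left_of_isPGroup hf hK hKN ht hKt htB) hKN hk))
  have := isNilpotent_of_commute hCc
  have hCA : C ≤ A := by
    refine le_of_primesPart_le fun t ht => ?_
    have hK := (primesPart_le {t} C).trans hCM
    have hKN := hCN.trans (normalizer_le_normalizer_primesPart {t} C)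
    by_cases htB : t ∣ Nat.card B
    · rw [h.eq_bot_of_le_normalizer hAM hK hKN ht (isPGroup_primesPart ht) (h.not_dvd_left ht htB)]
      exact bot_le
    · exact h.le_left_of_isPGroup hf hK hKN ht (isPGroup_primesPart ht) htB
  exact hF C hCA hCN hxC

theorem le_normalizer_of_le (h : MinimalFactorisation A B) {M : Subgroup G} (hAM : A ≤ M)
    (hM : M ≠ ⊤) : M ≤ normalizer (A : Set G) := by
  have := h.left
  obtain ⟨F, hFA, hFN, hF⟩ := exists_core A M
  have := isNilpotent_of_le hFA
  have key : A ≤ F := by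
    refine le_of_primesPart_le fun p hp => ?_
    obtain ⟨F', hFA', hFN', hF'⟩ := exists_core (primesPart {p}ᶜ A) M
    have hFF' : primesPart {p}ᶜ F ≤ F' := hF' _ (fun x hx => by
      rw [mem_primesPart_iff] at hx ⊢
      exact ⟨hFA hx.1, hx.2⟩) (hFN.trans (normalizer_le_normalizer_primesPart _ _))
    set E := M ⊓ centralizer (F' : Set G)
    have hEN : M ≤ normalizer (E : Set G) :=
      le_normalizer_inf le_normalizer (hFN'.trans (normalizer_le_normalizer_centralizer F'))
    have hEf := (h.isFactorised_of_le hAM).of_le_normalizer h.coprime inf_le_left hEN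
    have hEB : ∀ e ∈ E, e ∈ B → e = 1 := by
      intro e he heB
      refine h.eq_one_of_mem_centralizer hp heB (mem_centralizer_iff.2 fun a ha => ?_)
      have haA := primesPart_le _ _ ha
      have hcE : a * e * a⁻¹ * e⁻¹ ∈ E :=
        E.mul_mem (conj_mem_of_le_normalizer hEN (hAM haA) he) (E.inv_mem he)
      have hcF : a * e * a⁻¹ * e⁻¹ ∈ F := by
        refine h.mem_of_commute_core hAM hM hF hcE.1 fun f hf => ?_
        obtain ⟨u, hu, v, hv, rfl⟩ := exists_mul_of_mem {p} hf
        have h1 : a * e * a⁻¹ * e⁻¹ * v = v * (a * e * a⁻¹ * e⁻¹) :=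
          (mem_centralizer_iff.1 hcE.2 v (hFF' hv)).symm
        have hpA : primesPart {p} F ≤ primesPart {p} A := fun x hx => by
          rw [mem_primesPart_iff] at hx ⊢
          exact ⟨hFA hx.1, hx.2⟩
        have h2 : e⁻¹ * u * e⁻¹⁻¹ ∈ primesPart {p} F := conj_mem_of_le_normalizer
          (hFN.trans (normalizer_le_normalizer_primesPart _ _)) (M.inv_mem he.1) hu
        have h3 := commute_of_mem_primesPart disjoint_compl_right (hpA h2)
          ((primesPart {p}ᶜ A).inv_mem ha)
        have h4 := commute_of_mem_primesPart disjoint_compl_right (hpA hu) ha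
        have h5 : a * e * a⁻¹ * e⁻¹ * u = u * (a * e * a⁻¹ * e⁻¹) := by
          calc a * e * a⁻¹ * e⁻¹ * u = a * e * (a⁻¹ * (e⁻¹ * u * e⁻¹⁻¹)) * e⁻¹ := by group
            _ = a * u * e * a⁻¹ * e⁻¹ := by rw [← h3]; group
            _ = u * (a * e * a⁻¹ * e⁻¹) := by rw [← h4]; group
        rw [← mul_assoc, h5, mul_assoc u, h1, ← mul_assoc]
      have hcp : e * a⁻¹ * e⁻¹ ∈ primesPart {p}ᶜ A := by
        refine mem_primesPart_of ?_
          (isPrimesElt_conj e (isPrimesElt_inv (mem_primesPart_iff.1 ha).2))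
        have h1 := A.mul_mem (A.inv_mem haA) (hFA hcF)
        have h2 : a⁻¹ * (a * e * a⁻¹ * e⁻¹) = e * a⁻¹ * e⁻¹ := by group
        rwa [h2] at h1
      have hcp' : a * e * a⁻¹ * e⁻¹ ∈ primesPart {p}ᶜ A := by
        have h1 := (primesPart {p}ᶜ A).mul_mem ha hcp
        have h2 : a * (e * a⁻¹ * e⁻¹) = a * e * a⁻¹ * e⁻¹ := by group
        rwa [h2] at h1
      have hce : Commute (a * e * a⁻¹ * e⁻¹) e := mem_centralizer_iff.1 he.2 _
        (hFF' (mem_primesPart_of hcF (mem_primesPart_iff.1 hcp').2))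
      have hpow : (a * e * a⁻¹ * e⁻¹) ^ Nat.card B = 1 := by
        have h1 := hce.mul_pow (Nat.card B)
        rw [pow_card_of_mem heB, mul_one, inv_mul_cancel_right, conj_pow, pow_card_of_mem heB] at h1
        rw [← h1]
        group
      have h1 : a * e * a⁻¹ * e⁻¹ ∈ (⊥ : Subgroup G) := mem_of_pow_mem_of_coprime h.coprime
        (by rw [pow_card_of_mem (hFA hcF)]; exact one_mem _) (by rw [hpow]; exact one_mem _)
      rw [mem_bot, mul_inv_eq_one, mul_inv_eq_iff_eq_mul] at h1
      exact h1
    have hEA : E ≤ A := by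
      intro e he
      obtain ⟨a, ha, b, hb, -, hbE, rfl⟩ := hEf e he
      rw [hEB b hbE hb, mul_one]
      exact ha
    refine le_trans (fun x hx => ?_) (hF E hEA hEN)
    exact ⟨hAM (primesPart_le _ _ hx), mem_centralizer_iff.2 fun v hv =>
      (commute_of_mem_primesPart disjoint_compl_right hx (hFA' hv)).symm⟩
  rwa [le_antisymm hFA key] at hFN

theorem exists_mul_mem_normalizer (h : MinimalFactorisation A B) {p : ℕ} (hp : p.Prime) {g y : G}
    (hy : y ∈ primesPart {p} A) (hgy : g * y * g⁻¹ ∈ primesPart {p} A) :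
    ∃ c ∈ centralizer {g * y * g⁻¹}, c * g ∈ normalizer (A : Set G) := by
  have := h.left
  have hD : Group.IsNilpotent (primesPart {p}ᶜ A) := isNilpotent_primesPart
  have hDC : primesPart {p}ᶜ A ≤ centralizer {g * y * g⁻¹} := fun x hx =>
    mem_centralizer_singleton_iff.2 (commute_of_mem_primesPart disjoint_compl_right hgy hx).symm
  obtain ⟨m, hm, hcop⟩ := exists_card_eq_mul_of_coprime_index hDC (h.coprime_index {p}ᶜ)
  obtain ⟨c, hc, hc'⟩ := exists_conj_of_isNilpotent_hall
    (R₁ := (primesPart {p}ᶜ A).map (MulAut.conj g).toMonoidHom) (by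
      rintro _ ⟨x, hx, rfl⟩
      rw [mem_centralizer_singleton_iff]
      have h1 := commute_of_mem_primesPart disjoint_compl_right hy hx
      change g * x * g⁻¹ * (g * y * g⁻¹) = g * y * g⁻¹ * (g * x * g⁻¹)
      calc g * x * g⁻¹ * (g * y * g⁻¹) = g * (x * y) * g⁻¹ := by group
        _ = g * y * g⁻¹ * (g * x * g⁻¹) := by rw [← h1]; group) hDC
    (isNilpotent_map_conj hD g) hD (card_map_conj _ _) hm hcop
  refine ⟨c, hc, h.normalizer_primesPart_compl_le hp (mem_normalizer_of_conj_mem fun k hk => ?_)⟩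
  have h1 := hc' (g * k * g⁻¹) ⟨k, hk, rfl⟩
  have h2 : c * g * k * (c * g)⁻¹ = c * (g * k * g⁻¹) * c⁻¹ := by group
  rwa [h2]

theorem mem_normalizer_of_conj_central_mem (h : MinimalFactorisation A B) {r : ℕ} (hr : r.Prime)
    {g z : G} (hz : z ∈ primesPart {r} A) (hz1 : z ≠ 1) (hzA : ∀ a ∈ A, a * z = z * a)
    (hg : g * z * g⁻¹ ∈ A) : g ∈ normalizer (A : Set G) := by
  have := h.left
  obtain ⟨c, hc, hcg⟩ := h.exists_mul_mem_normalizer hr hz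
    (mem_primesPart_of hg (isPrimesElt_conj g (mem_primesPart_iff.1 hz).2))
  have h1 : g⁻¹ * c * g ∈ normalizer (A : Set G) := by
    refine h.le_normalizer_of_le (le_normalizer_centralizer_singleton hzA)
      (centralizer_ne_top_of_ne_one h.not_comm hz1) (mem_centralizer_singleton_iff.2 ?_)
    rw [mem_centralizer_singleton_iff] at hc
    calc g⁻¹ * c * g * z = g⁻¹ * (c * (g * z * g⁻¹)) * g := by group
      _ = z * (g⁻¹ * c * g) := by rw [hc]; group
  have h2 := mul_mem hcg (inv_mem h1)
  have h3 : c * g * (g⁻¹ * c * g)⁻¹ = g := by group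
  rwa [h3] at h2

theorem le_normalizer_of_isFactorised (h : MinimalFactorisation A B) {H : Subgroup G} (hH : H ≠ ⊤)
    (hf : IsFactorised A B H) {r : ℕ} (hr : r.Prime) (hrA : primesPart {r} A ≠ ⊥)
    (hrH : primesPart {r} A ≤ H) : H ≤ normalizer (A : Set G) := by
  have := h.left
  obtain ⟨z, hz, hz1, hzA⟩ := exists_central_of_primesPart_ne_bot hrA
  obtain ⟨C, hCH, hCN, hCc, hzC⟩ := h.exists_commutative_normal hH hf hr hrA hrH hz hzA
  have := isNilpotent_of_commute hCc
  have hKN := hCN.trans (normalizer_le_normalizer_primesPart {r} C)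
  have hKA := h.le_left_of_isPGroup hf ((primesPart_le {r} C).trans hCH) hKN hr
    (isPGroup_primesPart hr) (h.not_dvd_right hr (dvd_card_of_primesPart_ne_bot hr hrA))
  exact fun x hx => h.mem_normalizer_of_conj_central_mem hr hz hz1 hzA (hKA
    (conj_mem_of_le_normalizer hKN hx (mem_primesPart_of hzC (mem_primesPart_iff.1 hz).2)))

theorem centralizer_le_of_mem_normalizer (h : MinimalFactorisation A B) {p : ℕ} (hp : p.Prime)
    {a : G}
    (ha : a ∈ primesPart {p} A) (ha1 : a ≠ 1) (haB : a ∈ normalizer (B : Set G)) :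
    centralizer {a} ≤ normalizer (A : Set G) := by
  have := h.left
  obtain ⟨r, hr, -, hrA, hrp⟩ := exists_prime_ne_of_primesPart_compl_ne_bot (h.left_ne p hp)
  have haA := primesPart_le _ _ ha
  refine h.le_normalizer_of_isFactorised (centralizer_ne_top_of_ne_one h.not_comm ha1) ?_ hr hrA
    fun x hx => mem_centralizer_singleton_iff.2
      (commute_of_mem_primesPart disjoint_compl_right ha (hrp hx)).symm
  intro x hx
  obtain ⟨u, hu, b, hb, rfl⟩ := h.exists_mul x
  rw [mem_centralizer_singleton_iff] at hx
  have h1 : b * a * b⁻¹ = u⁻¹ * a * u := by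
    calc b * a * b⁻¹ = u⁻¹ * (u * b * a) * b⁻¹ := by group
      _ = u⁻¹ * a * u := by rw [hx]; group
  have h2 : a⁻¹ * (b * a * b⁻¹) ∈ A := by
    rw [h1]
    exact A.mul_mem (A.inv_mem haA) (A.mul_mem (A.mul_mem (A.inv_mem hu) haA) hu)
  have h3 : a⁻¹ * (b * a * b⁻¹) ∈ B := by
    have h4 := conj_mem_of_le_normalizer le_rfl (inv_mem haB) hb
    have h5 : a⁻¹ * (b * a * b⁻¹) = a⁻¹ * b * a⁻¹⁻¹ * b⁻¹ := by group
    rw [h5]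
    exact B.mul_mem h4 (B.inv_mem hb)
  have h4 : a⁻¹ * (b * a * b⁻¹) = 1 :=
    disjoint_def.1 (disjoint_of_coprime_natCard h.coprime) h2 h3
  rw [inv_mul_eq_one, eq_mul_inv_iff_mul_eq] at h4
  have hbC : b ∈ centralizer {a} := mem_centralizer_singleton_iff.2 h4.symm
  have huC : u ∈ centralizer {a} := by
    simpa using mul_mem (mem_centralizer_singleton_iff.2 hx) (inv_mem hbC)
  exact ⟨u, hu, b, hb, huC, hbC, rfl⟩

end MinimalFactorisation

end

section

open Subgroup

section
variable {G : Type*} [Group G]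

theorem exists_card_eq_mul_of_maximal [Finite G] {p : ℕ} (hp : p.Prime) {S L : Subgroup G}
    (hSL : S ≤ L)
    (hS : IsPGroup p S) (hmax : ∀ Q ≤ L, IsPGroup p Q → S ≤ Q → Q ≤ S) :
    ∃ m, Nat.card L = Nat.card S * m ∧ ¬ p ∣ m := by
  have := Fact.mk hp
  obtain ⟨Q, hQ⟩ := (hS.of_equiv (subgroupOfEquivOfLe hSL).symm).exists_le_sylow
  have h1 : (Q : Subgroup L).map L.subtype ≤ S := by
    refine hmax _ (map_subtype_le _) (Q.2.map _) fun x hx => ?_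
    exact ⟨⟨x, hSL hx⟩, hQ (mem_subgroupOf.2 hx), rfl⟩
  have h2 : (Q : Subgroup L) = S.subgroupOf L :=
    le_antisymm (fun x hx => mem_subgroupOf.2 (h1 ⟨x, hx, rfl⟩)) hQ
  refine ⟨(Q : Subgroup L).index, ?_, Q.not_dvd_index⟩
  rw [← Nat.card_congr (subgroupOfEquivOfLe hSL).toEquiv, ← h2, card_mul_index]

theorem exists_sylow_le_normalizer [Finite G] {r q : ℕ} (hr : r.Prime) (hq : q.Prime)
    {R K : Subgroup G} (hR : IsPGroup r R) (hRK : R ≤ normalizer (K : Set G))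
    (hrK : ¬ r ∣ Nat.card K) :
    ∃ E ≤ K, IsPGroup q E ∧ R ≤ normalizer (E : Set G) ∧ (q ∣ Nat.card K → E ≠ ⊥) := by
  have := Fact.mk hr
  have := Fact.mk hq
  let φ : R →* MulAut K := K.normalizerMonoidHom.comp (inclusion hRK)
  let _ : MulDistribMulAction R K := MulDistribMulAction.compHom K φ
  have hnd : ¬ r ∣ Nat.card (Sylow q K) := by
    have Q : Sylow q K := default
    intro h
    exact hrK ((h.trans Q.card_dvd_index).trans (index_dvd_card _))
  obtain ⟨Q, hQ⟩ := hR.nonempty_fixed_point_of_prime_not_dvd_card (Sylow q K) hnd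
  refine ⟨(Q : Subgroup K).map K.subtype, map_subtype_le _, Q.2.map _, ?_, fun hd h0 => ?_⟩
  · refine le_normalizer_of_conj ?_
    rintro x hx _ ⟨k, hk, rfl⟩
    have h1 : (⟨x, hx⟩ : R) • k ∈ ((⟨x, hx⟩ : R) • Q : Sylow q K) :=
      Set.smul_mem_smul_set hk
    rw [hQ] at h1
    exact ⟨_, h1, rfl⟩
  · rw [map_eq_bot_iff_of_injective _ (subtype_injective K)] at h0
    exact Q.ne_bot_of_dvd_card hd h0

end

namespace MinimalFactorisation

variable {G : Type*} [Group G] [Finite G] {A B : Subgroup G}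

theorem centralizer_inf_le (h : MinimalFactorisation A B) {C : Subgroup G}
    (hC : C ≤ normalizer (A : Set G)) (hq : ∀ q : ℕ, q.Prime → q ∣ Nat.card C → q ∣ Nat.card A) :
    C ≤ A := by
  intro x hx
  have hcop : (Nat.card B).Coprime (Nat.card C) := Nat.coprime_of_dvd fun q hq' h1 h2 =>
    h.not_dvd_right hq' (hq q hq' h2) h1
  refine mem_of_pow_mem_of_coprime hcop ?_ (by rw [pow_card_of_mem hx]; exact one_mem _)
  have h1 := pow_index_mem (A.subgroupOf (normalizer (A : Set G))) (⟨x, hC hx⟩ :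
    normalizer (A : Set G))
  have h2 : x ^ A.relIndex (normalizer (A : Set G)) ∈ A := h1
  obtain ⟨k, hk⟩ := relIndex_dvd_index_of_le (le_normalizer (H := A))
  rw [← h.index_eq, hk, pow_mul]
  exact A.pow_mem h2 k

variable [IsSimpleGroup G]

theorem centralizer_le_of_exists (h : MinimalFactorisation A B) {p q : ℕ} (hp : p.Prime)
    (hq : q.Prime) (hqA : ¬ q ∣ Nat.card A) {a e : G} (ha : a ∈ primesPart {p} A) (ha1 : a ≠ 1)
    (he : e ∈ normalizer (A : Set G)) (hea : e ∈ centralizer {a}) (hoe : orderOf e = q) :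
    centralizer {a} ≤ normalizer (A : Set G) := by
  have heq : IsPGroup q (zpowers e) :=
    IsPGroup.of_card (n := 1) (by rw [Nat.card_zpowers, hoe, pow_one])
  have he1 : e ≠ 1 := by
    rintro rfl
    exact hq.one_lt.ne (by simpa using hoe)
  obtain ⟨u, hu, hue⟩ := h.symm.exists_conj_mem_primesPart hq hqA heq
  have huN := le_normalizer hu
  have h1 := h.symm.centralizer_le_of_mem_normalizer hq (hue e (mem_zpowers e))
    (by simpa using he1) (mul_mem (mul_mem huN he) (inv_mem huN))
  have h2 : u * a * u⁻¹ ∈ normalizer (B : Set G) := by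
    refine h1 (mem_centralizer_singleton_iff.2 ?_)
    rw [mem_centralizer_singleton_iff] at hea
    calc u * a * u⁻¹ * (u * e * u⁻¹) = u * (a * e) * u⁻¹ := by group
      _ = u * e * u⁻¹ * (u * a * u⁻¹) := by rw [← hea]; group
  have h3 := h.centralizer_le_of_mem_normalizer hp
    (conj_mem_of_le_normalizer (le_normalizer_primesPart _) hu ha) (by simpa using ha1) h2
  intro x hx
  have h4 : u * x * u⁻¹ ∈ normalizer (A : Set G) := by
    refine h3 (mem_centralizer_singleton_iff.2 ?_)
    rw [mem_centralizer_singleton_iff] at hx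
    calc u * x * u⁻¹ * (u * a * u⁻¹) = u * (x * a) * u⁻¹ := by group
      _ = u * a * u⁻¹ * (u * x * u⁻¹) := by rw [hx]; group
  have h5 := mul_mem (mul_mem (inv_mem huN) h4) huN
  have h6 : u⁻¹ * (u * x * u⁻¹) * u = x := by group
  rwa [h6] at h5

theorem le_primesPart_of_mem (h : MinimalFactorisation A B) {p : ℕ} (hp : p.Prime)
    (hpA : p ∣ Nat.card A) {z : G} (hz : z ∈ primesPart {p} A) (hz1 : z ≠ 1)
    (hzA : ∀ a ∈ A, a * z = z * a) {Q : Subgroup G} (hQ : IsPGroup p Q) (hzQ : z ∈ Q) :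
    Q ≤ primesPart {p} A := by
  obtain ⟨b, -, hb⟩ := h.exists_conj_mem_primesPart hp (h.not_dvd_right hp hpA) hQ
  have hbN := normalizer_le_normalizer_primesPart {p} A
    (h.mem_normalizer_of_conj_central_mem hp hz hz1 hzA (primesPart_le _ _ (hb z hzQ)))
  exact fun x hx => (mem_normalizer_iff.1 hbN x).2 (hb x hx)

theorem centralizer_le (h : MinimalFactorisation A B) {p : ℕ} (hp : p.Prime) {a : G}
    (ha : a ∈ primesPart {p} A) (ha1 : a ≠ 1) : centralizer {a} ≤ normalizer (A : Set G) := by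
  have := h.left
  set C := centralizer ({a} : Set G)
  by_cases hcase : ∃ q : ℕ, q.Prime ∧ ¬ q ∣ Nat.card A ∧
      q ∣ Nat.card (C ⊓ normalizer (A : Set G) : Subgroup G)
  · obtain ⟨q, hq, hqA, hd⟩ := hcase
    have := Fact.mk hq
    obtain ⟨e, he⟩ := exists_prime_orderOf_dvd_card' q hd
    exact h.centralizer_le_of_exists hp hq hqA ha ha1 e.2.2 e.2.1 (by rwa [orderOf_coe])
  have hCM : C ⊓ normalizer (A : Set G) ≤ A := h.centralizer_inf_le inf_le_right
    fun q hq hd => by_contra fun hqA => hcase ⟨q, hq, hqA, hd⟩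
  have hAp : primesPart {p} A ≠ ⊥ := fun h0 => ha1 (mem_bot.1 (h0 ▸ ha))
  have hpA := dvd_card_of_primesPart_ne_bot hp hAp
  obtain ⟨r, hr, hrp, hrA, hrA'⟩ := exists_prime_ne_of_primesPart_compl_ne_bot (h.left_ne p hp)
  have hrdA := dvd_card_of_primesPart_ne_bot hr hrA
  have hpC : primesPart {p}ᶜ A ≤ C := fun x hx => mem_centralizer_singleton_iff.2
    (commute_of_mem_primesPart disjoint_compl_right ha hx).symm
  obtain ⟨z, hz, hz1, hzA⟩ := exists_central_of_primesPart_ne_bot hAp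
  obtain ⟨w, hw, hw1, hwA⟩ := exists_central_of_primesPart_ne_bot hrA
  have hzS : z ∈ C ⊓ primesPart {p} A :=
    ⟨mem_centralizer_singleton_iff.2 (hzA a (primesPart_le _ _ ha)).symm, hz⟩
  have hSp : IsPGroup p (C ⊓ primesPart {p} A : Subgroup G) :=
    (isPGroup_primesPart (A := A) hp).to_le inf_le_right
  have hSyl : ∀ L ≤ C, C ⊓ primesPart {p} A ≤ L →
      ∃ m, Nat.card L = Nat.card (C ⊓ primesPart {p} A : Subgroup G) * m ∧ ¬ p ∣ m :=
    fun L hLC hSL => exists_card_eq_mul_of_maximal hp hSL hSp fun Q hQL hQ hSQ =>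
      le_inf (hQL.trans hLC) (h.le_primesPart_of_mem hp hpA hz hz1 hzA hQ (hSQ hzS))
  have hfus : ∀ y ∈ primesPart {r} A, ∀ c ∈ C, c * y * c⁻¹ ∈ primesPart {r} A →
      ∃ u ∈ primesPart {r} A, c * y * c⁻¹ = u * y * u⁻¹ := by
    intro y hy c hc hcy
    have hSL : C ⊓ primesPart {p} A ≤ C ⊓ centralizer {c * y * c⁻¹} := fun s hs =>
      ⟨hs.1, mem_centralizer_singleton_iff.2
        (commute_of_mem_primesPart disjoint_compl_right hs.2 (hrA' hcy))⟩
    obtain ⟨m, hm, hpm⟩ := hSyl _ inf_le_left hSL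
    obtain ⟨d, hd, hd'⟩ := exists_conj_le_of_isPGroup hp (L := C ⊓ centralizer {c * y * c⁻¹})
      (P := (C ⊓ primesPart {p} A).map (MulAut.conj c).toMonoidHom) (by
        rintro _ ⟨s, hs, rfl⟩
        refine ⟨C.mul_mem (C.mul_mem hc hs.1) (C.inv_mem hc), mem_centralizer_singleton_iff.2 ?_⟩
        have h1 := commute_of_mem_primesPart disjoint_compl_right hs.2 (hrA' hy)
        change c * s * c⁻¹ * (c * y * c⁻¹) = c * y * c⁻¹ * (c * s * c⁻¹)
        calc c * s * c⁻¹ * (c * y * c⁻¹) = c * (s * y) * c⁻¹ := by group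
          _ = c * y * c⁻¹ * (c * s * c⁻¹) := by rw [h1]; group) hSL (hSp.map _) hSp hm hpm
    have h1 := hd' (c * z * c⁻¹) ⟨z, hzS, rfl⟩
    have h2 : d * (c * z * c⁻¹) * d⁻¹ = d * c * z * (d * c)⁻¹ := by group
    rw [h2] at h1
    have h3 := hCM ⟨C.mul_mem hd.1 hc,
      h.mem_normalizer_of_conj_central_mem hp hz hz1 hzA (primesPart_le _ _ h1.2)⟩
    obtain ⟨u, hu, v, hv, huv⟩ := exists_mul_of_mem {r} h3
    refine ⟨u, hu, ?_⟩
    have h4 := commute_of_mem_primesPart disjoint_compl_right hy hv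
    have h5 := mem_centralizer_singleton_iff.1 hd.2
    calc c * y * c⁻¹ = c * y * c⁻¹ * d * d⁻¹ := by group
      _ = (d * c) * y * (d * c)⁻¹ := by rw [← h5]; group
      _ = u * (v * y) * v⁻¹ * u⁻¹ := by rw [huv]; group
      _ = u * y * u⁻¹ := by rw [← h4]; group
  have hrC := hrA'.trans hpC
  obtain ⟨m, hm, hrm⟩ := exists_card_eq_mul_of_coprime_index hrC (h.coprime_index {r})
  have hrK : ¬ r ∣ Nat.card (primesPart {r}ᶜ C) :=
    not_dvd_card_primesPart_compl_of_fusion hr hrC (isPGroup_primesPart hr) hm (fun hd => by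
      obtain ⟨q, hq, h1⟩ := exists_prime_dvd_of_ne_bot hrA
      obtain rfl : q = r := by simpa using prime_mem_of_dvd_card_primesPart hq h1
      exact Nat.not_coprime_of_dvd_of_dvd hr.one_lt h1 hd hrm) hfus
  have hKN : C ≤ normalizer (primesPart {r}ᶜ C : Set G) :=
    le_normalizer.trans (normalizer_le_normalizer_primesPart _ _)
  have hq : ∀ q : ℕ, q.Prime → q ∣ Nat.card C → q ∣ Nat.card A := by
    intro q hq hd
    by_contra hqA
    have := Fact.mk hq
    obtain ⟨x, hx⟩ := exists_prime_orderOf_dvd_card' q hd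
    rw [← orderOf_coe] at hx
    have hqK : q ∣ Nat.card (primesPart {r}ᶜ C) := by
      have h1 : (x : G) ∈ primesPart {r}ᶜ C := by
        refine mem_primesPart_of x.2 fun t ht htd => ?_
        rw [hx, Nat.prime_dvd_prime_iff_eq ht hq] at htd
        rintro rfl
        exact hqA (htd ▸ hrdA)
      rw [← hx]
      exact orderOf_dvd_natCard _ h1
    obtain ⟨E, hEK, hE, hEN, hE0⟩ := exists_sylow_le_normalizer hr hq (isPGroup_primesPart (A := A)
      hr)
      (hrC.trans hKN) hrK
    refine hE0 hqK ?_
    have h1 := h.commute_of_isPGroup hr hq hqA hE hrA hEN hw hwA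
    have h2 : E ≤ A := fun e he => hCM ⟨primesPart_le _ _ (hEK he),
      h.le_normalizer_of_le (le_normalizer_centralizer_singleton hwA)
        (centralizer_ne_top_of_ne_one h.not_comm hw1) (mem_centralizer_singleton_iff.2 (h1 e he))⟩
    rw [eq_bot_iff]
    exact fun e he => mem_bot.2 (eq_one_of_mem_isPGroup hq hE hqA he (h2 he))
  have hCA : C ≤ A := by
    have h1 : (C ⊓ A).relIndex C = 1 := by
      by_contra h1
      obtain ⟨t, ht, htd⟩ := Nat.exists_prime_and_dvd h1
      have h2 : t ∣ Nat.card C := htd.trans (index_dvd_card _)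
      by_cases htp : t = p
      · subst htp
        obtain ⟨m, hm, hpm⟩ := hSyl C le_rfl inf_le_left
        have h3 : m = (C ⊓ primesPart {t} A).relIndex C := by
          refine Nat.eq_of_mul_eq_mul_left
            (Nat.card_pos (α := (C ⊓ primesPart {t} A : Subgroup G))) ?_
          rw
            [← hm, ← Nat.card_congr
              (subgroupOfEquivOfLe (inf_le_left (a := C) (b := primesPart {t} A))).toEquiv,
                relIndex, card_mul_index]
        rw [h3] at hpm
        exact hpm (htd.trans (relIndex_dvd_of_le_left _ (inf_le_inf_left _ (primesPart_le _ _))))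
      · have htA := hq t ht h2
        have h3 : primesPart {t} A ≤ C ⊓ A :=
          le_inf ((primesPart_mono (by simpa using fun h => htp h.symm) A).trans hpC)
            (primesPart_le _ _)
        exact h.not_dvd_index ht htA ((htd.trans (relIndex_dvd_of_le_left _ h3)).trans
          (relIndex_dvd_index_of_le (h3.trans inf_le_left)))
    exact (relIndex_eq_one.1 h1).trans inf_le_right
  exact hCA.trans le_normalizer

theorem card_le (h : MinimalFactorisation A B) : Nat.card A ≤ Nat.card B := by
  by_contra! hlt
  have := h.left
  have hN := normalizer_ne_top_of_ne h.ne_bot h.ne_top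
  obtain ⟨x, hx⟩ : ∃ x, x ∉ normalizer (A : Set G) := by
    by_contra! hc
    exact hN (eq_top_iff' _ |>.2 hc)
  have hne : A ⊓ A.map (MulAut.conj x).toMonoidHom ≠ ⊥ := by
    intro h0
    have h1 := Nat.card_le_card_of_injective _ (mul_injective_of_disjoint (disjoint_iff.2 h0))
    rw [Nat.card_prod, card_map_conj, h.card_eq] at h1
    exact absurd (Nat.le_of_mul_le_mul_left h1 Nat.card_pos) (by omega)
  obtain ⟨p, hp, hd⟩ := exists_prime_dvd_of_ne_bot hne
  have := Fact.mk hp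
  obtain ⟨a, hoa⟩ := exists_prime_orderOf_dvd_card' p hd
  rw [← orderOf_coe] at hoa
  have ha1 : (a : G) ≠ 1 := by
    intro h1
    rw [h1, orderOf_one] at hoa
    exact hp.one_lt.ne hoa
  have hap : IsPrimesElt {p} (a : G) :=
    (isPrimesElt_singleton_iff hp).2 ⟨1, by rw [pow_one, ← hoa, pow_orderOf_eq_one]⟩
  have haA := mem_primesPart_of a.2.1 hap
  have hyA : x⁻¹ * a * x ∈ primesPart {p} A :=
    mem_primesPart_of (mem_map_conj.1 a.2.2) (by simpa using isPrimesElt_conj x⁻¹ hap)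
  have hxy : x * (x⁻¹ * a * x) * x⁻¹ = a := by group
  obtain ⟨c, hc, hcx⟩ := h.exists_mul_mem_normalizer hp hyA (g := x) (by rwa [hxy])
  rw [hxy] at hc
  have h1 := mul_mem (inv_mem (h.centralizer_le hp haA ha1 hc)) hcx
  rw [inv_mul_cancel_left] at h1
  exact hx h1

theorem false (h : MinimalFactorisation A B) : False := by
  have h1 := le_antisymm h.card_le h.symm.card_le
  have h2 := h.coprime
  rw [← h1, Nat.coprime_self] at h2
  exact h.ne_bot (card_eq_one.1 h2)

end MinimalFactorisation

end

section

open Subgroup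

variable {G : Type*} [Group G]

theorem isNilpotent_subgroupOf {A : Subgroup G} (hA : Group.IsNilpotent A) (H : Subgroup G) :
    Group.IsNilpotent (A.subgroupOf H) :=
  let f : A.subgroupOf H →* A :=
    (H.subtype.comp (A.subgroupOf H).subtype).codRestrict A fun x => x.2
  have hf : Function.Injective f := fun x y h =>
    Subtype.ext (Subtype.ext (congrArg (fun a : A => (a : G)) h))
  Subgroup.isNilpotent_of_ker_le_center f (by
    rw [(MonoidHom.ker_eq_bot_iff f).2 hf]
    exact bot_le)

theorem primesPart_compl_ne_bot [Finite G] [IsSimpleGroup G]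
    (hna : ¬ ∀ x y : G, x * y = y * x) {A B : Subgroup G} (hA : Group.IsNilpotent A)
    (hB : Group.IsNilpotent B) (hc : (Nat.card A).Coprime (Nat.card B))
    (hAB : ∀ g : G, ∃ a ∈ A, ∃ b ∈ B, g = a * b) {p : ℕ} (hp : p.Prime) :
    primesPart {p}ᶜ A ≠ ⊥ := by
  intro h
  have := Fact.mk hp
  have hcard := card_primesPart_mul (A := A) {p}
  rw [h, card_bot, mul_one] at hcard
  obtain ⟨k, hk⟩ := IsPGroup.iff_card.1 (isPGroup_primesPart (A := A) hp)
  by_cases hBb : B = ⊥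
  · have hAt : ∀ g, g ∈ A := by
      intro g
      obtain ⟨a, ha, b, hb, rfl⟩ := hAB g
      rw [hBb, mem_bot] at hb
      rwa [hb, mul_one]
    have h1 : Group.IsSolvable G := by
      refine Group.isSolvable_of_surjective (f := A.subtype) fun g => ⟨⟨g, hAt g⟩, rfl⟩
    exact hna (IsSimpleGroup.comm_iff_isSolvable.2 h1)
  · obtain ⟨q, hq, hqB⟩ := exists_prime_dvd_of_ne_bot hBb
    obtain ⟨z, -, hz1, hzB⟩ := exists_central_of_primesPart_ne_bot
      (primesPart_singleton_ne_bot hq hqB)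
    have hle : B ≤ centralizer ({z} : Set G) := fun b hb =>
      mem_centralizer_singleton_iff.2 (hzB b hb)
    have hidx : B.index = p ^ k := by
      have h1 := card_eq_mul_of_forall_exists_mul hc hAB
      rw [← B.card_mul_index, mul_comm (Nat.card A), ← hcard, hk] at h1
      exact Nat.eq_of_mul_eq_mul_left Nat.card_pos h1
    obtain ⟨j, -, hj⟩ := (Nat.dvd_prime_pow hp).1 (hidx ▸ index_dvd_of_le hle)
    exact index_centralizer_ne_prime_pow hna hz1 hp j hj

/-- A finite group which is the product of two nilpotent subgroups of coprime orders is
solvable. -/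
theorem isSolvable_of_nilpotent_mul_of_coprime.{u} {G : Type u} [Group G] [Finite G]
    {A B : Subgroup G} (hA : Group.IsNilpotent A) (hB : Group.IsNilpotent B)
    (hc : (Nat.card A).Coprime (Nat.card B))
    (hAB : ∀ g : G, ∃ a ∈ A, ∃ b ∈ B, g = a * b) : Group.IsSolvable G := by
  induction hn : Nat.card G using Nat.strong_induction_on generalizing G with
  | _ n ih =>
  have hsub : ∀ H : Subgroup G, H ≠ ⊤ → IsFactorised A B H → Group.IsSolvable H := by
    intro H hH hf
    have hlt : Nat.card H < n :=
      hn ▸ lt_of_le_of_ne (card_le_card_group H) fun h => hH (card_eq_iff_eq_top _ |>.1 h)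
    have hdA : Nat.card (A.subgroupOf H) ∣ Nat.card A :=
      card_comap_dvd_of_injective _ _ H.subtype_injective
    have hdB : Nat.card (B.subgroupOf H) ∣ Nat.card B :=
      card_comap_dvd_of_injective _ _ H.subtype_injective
    refine ih _ hlt (A := A.subgroupOf H) (B := B.subgroupOf H) ?_ ?_
      ((hc.coprime_dvd_left hdA).coprime_dvd_right hdB) ?_ rfl
    · exact isNilpotent_subgroupOf hA H
    · exact isNilpotent_subgroupOf hB H
    · intro g
      obtain ⟨a, ha, b, hb, ha', hb', h⟩ := hf g g.2
      exact ⟨⟨a, ha'⟩, ha, ⟨b, hb'⟩, hb, Subtype.ext h⟩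
  by_contra hns
  have hna : ¬ ∀ x y : G, x * y = y * x := fun h => hns (Group.isSolvable_of_comm h)
  have hnt : Nontrivial G := by
    by_contra h
    have := not_nontrivial_iff_subsingleton.1 h
    exact hns inferInstance
  have hsimple : IsSimpleGroup G := by
    refine ⟨fun N hN => ?_⟩
    by_contra! hne
    have h1 : Group.IsSolvable N := by
      refine hsub N hne.2 (IsFactorised.of_le_normalizer (H := ⊤) ?_ hc le_top ?_)
      · intro g _
        obtain ⟨a, ha, b, hb, h⟩ := hAB g
        exact ⟨a, ha, b, hb, mem_top a, mem_top b, h⟩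
      · rw [normalizer_eq_top_iff.2 hN]
    have hlt : Nat.card (G ⧸ N) < n := by
      rw [← hn, ← N.card_mul_index, ← index_eq_card]
      exact lt_mul_of_one_lt_left (Nat.pos_of_ne_zero N.index_ne_zero_of_finite)
        (N.one_lt_card_iff_ne_bot.2 hne.1)
    have h2 : Group.IsSolvable (G ⧸ N) := by
      refine ih _ hlt (A := A.map (QuotientGroup.mk' N)) (B := B.map (QuotientGroup.mk' N))
        ?_ ?_ ((hc.coprime_dvd_left (card_map_dvd _ _)).coprime_dvd_right (card_map_dvd _ _)) ?_ rfl
      · exact Group.nilpotent_of_surjective _ ((QuotientGroup.mk' N).subgroupMap_surjective A)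
      · exact Group.nilpotent_of_surjective _ ((QuotientGroup.mk' N).subgroupMap_surjective B)
      · intro g
        obtain ⟨g, rfl⟩ := QuotientGroup.mk'_surjective N g
        obtain ⟨a, ha, b, hb, rfl⟩ := hAB g
        exact ⟨_, mem_map_of_mem _ ha, _, mem_map_of_mem _ hb, map_mul _ _ _⟩
    exact hns ((Group.isSolvable_iff_subgroup_quotient N).2 ⟨h1, h2⟩)
  have hBA : ∀ g : G, ∃ b ∈ B, ∃ a ∈ A, g = b * a := by
    intro g
    obtain ⟨a, ha, b, hb, h⟩ := hAB g⁻¹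
    exact ⟨b⁻¹, B.inv_mem hb, a⁻¹, A.inv_mem ha, by rw [← mul_inv_rev, ← h, inv_inv]⟩
  have hmin : MinimalFactorisation A B :=
    { not_comm := hna
      left := hA
      right := hB
      coprime := hc
      exists_mul := hAB
      solvable := hsub
      left_ne := fun p hp => primesPart_compl_ne_bot hna hA hB hc hAB hp
      right_ne := fun p hp => primesPart_compl_ne_bot hna hB hA hc.symm hBA hp }
  exact hmin.false

end

section

open Subgroup

variable {G : Type*} [Group G]

theorem relIndex_eq_of_forall_exists_mul {H K L : Subgroup G} (hKL : K ≤ L)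
    (h : ∀ l ∈ L, ∃ k ∈ K, ∃ x ∈ H, l = k * x) : H.relIndex K = H.relIndex L := by
  refine Nat.card_congr (Equiv.ofBijective (quotientSubgroupOfEmbeddingOfLE H hKL)
    ⟨(quotientSubgroupOfEmbeddingOfLE H hKL).injective, fun y => ?_⟩)
  obtain ⟨⟨l, hl⟩, rfl⟩ := QuotientGroup.mk_surjective y
  obtain ⟨k, hk, x, hx, rfl⟩ := h l hl
  refine ⟨QuotientGroup.mk ⟨k, hk⟩, ?_⟩
  rw [quotientSubgroupOfEmbeddingOfLE_apply_mk, QuotientGroup.eq, mem_subgroupOf]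
  simpa using hx

theorem exists_mul_of_relIndex_eq [Finite G] {H K L : Subgroup G} (hKL : K ≤ L)
    (h : H.relIndex K = H.relIndex L) : ∀ l ∈ L, ∃ k ∈ K, ∃ x ∈ H, l = k * x := by
  intro l hl
  have hsurj := ((quotientSubgroupOfEmbeddingOfLE H hKL).injective.bijective_of_nat_card_le
    h.ge).surjective
  obtain ⟨y, hy⟩ := hsurj (QuotientGroup.mk ⟨l, hl⟩)
  obtain ⟨⟨k, hk⟩, rfl⟩ := QuotientGroup.mk_surjective y
  rw [quotientSubgroupOfEmbeddingOfLE_apply_mk, QuotientGroup.eq, mem_subgroupOf] at hy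
  exact ⟨k, hk, k⁻¹ * l, hy, by group⟩

theorem card_inf_mul_relIndex (H K : Subgroup G) :
    Nat.card (H ⊓ K : Subgroup G) * H.relIndex K = Nat.card K := by
  rw [← inf_relIndex_right, relIndex, ← card_mul_index ((H ⊓ K).subgroupOf K),
    Nat.card_congr (subgroupOfEquivOfLe inf_le_right).toEquiv]

/-- In a product of two nilpotent groups, the product of the Sylow `p`-subgroups of the factors
is a Sylow `p`-subgroup. -/
theorem exists_isPGroup_eq_mul [Finite G] {A B : Subgroup G} (hA : Group.IsNilpotent A)
    (hB : Group.IsNilpotent B) (hAB : ∀ g : G, ∃ a ∈ A, ∃ b ∈ B, g = a * b) {p : ℕ}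
    (hp : p.Prime) :
    ∃ P : Subgroup G, IsPGroup p P ∧ primesPart {p} A ≤ P ∧ primesPart {p} B ≤ P ∧
      ∀ x ∈ P, ∃ b ∈ primesPart {p} B, ∃ a ∈ primesPart {p} A, x = b * a := by
  have := Fact.mk hp
  obtain ⟨Q, hQ⟩ := (isPGroup_primesPart (A := A) hp).exists_le_sylow
  obtain ⟨l, -, hl⟩ := exists_conj_le_of_isPGroup hp (le_top (a := primesPart {p} B))
    (le_top (a := (Q : Subgroup G))) (isPGroup_primesPart hp) Q.2
    (by rw [card_top, card_mul_index]) Q.not_dvd_index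
  obtain ⟨a, ha, b, hb, rfl⟩ := hAB l
  set P := (Q : Subgroup G).map (MulAut.conj a⁻¹).toMonoidHom with hP
  have hAP : primesPart {p} A ≤ P := fun x hx => mem_map_conj.2 <| by
    rw [inv_inv]
    exact hQ (conj_mem_primesPart (fun y hy => mul_mem (mul_mem ha hy) (inv_mem ha)) hx)
  have hBP : primesPart {p} B ≤ P := fun x hx => mem_map_conj.2 <| by
    have h1 := hl _ (conj_mem_primesPart (g := b⁻¹)
      (fun y hy => mul_mem (mul_mem (inv_mem hb) hy) (inv_mem (inv_mem hb))) hx)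
    have h2 : a * b * (b⁻¹ * x * b⁻¹⁻¹) * (a * b)⁻¹ = a⁻¹⁻¹ * x * a⁻¹ := by group
    rwa [h2] at h1
  refine ⟨P, Q.2.map _, hAP, hBP, exists_mul_of_relIndex_eq hBP ?_⟩
  have hinf : primesPart {p} A ⊓ primesPart {p} B = primesPart {p} (A ⊓ B) := by
    have : Group.IsNilpotent (A ⊓ B : Subgroup G) := isNilpotent_of_le inf_le_left
    ext x
    simp only [mem_inf, mem_primesPart_iff]
    tauto
  have hidx : A.relIndex B = A.index := by
    rw [← relIndex_top_right]
    refine relIndex_eq_of_forall_exists_mul le_top fun g _ => ?_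
    obtain ⟨a, ha, b, hb, h⟩ := hAB g⁻¹
    exact ⟨b⁻¹, B.inv_mem hb, a⁻¹, A.inv_mem ha, by rw [← mul_inv_rev, ← h, inv_inv]⟩
  have hcard : Nat.card (A ⊓ B : Subgroup G) * Nat.card G = Nat.card A * Nat.card B := by
    rw [← card_inf_mul_relIndex A B, hidx, ← A.card_mul_index]
    ring
  have hcard' : Nat.card (primesPart {p} A ⊓ primesPart {p} B : Subgroup G) * Nat.card P =
      Nat.card (primesPart {p} A) * Nat.card (primesPart {p} B) := by
    have : Group.IsNilpotent (A ⊓ B : Subgroup G) := isNilpotent_of_le inf_le_left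
    rw [hinf, hP, card_map_conj, Q.card_eq_multiplicity, card_primesPart_singleton hp,
      card_primesPart_singleton hp, card_primesPart_singleton hp, ← pow_add, ← pow_add,
      ← Finsupp.add_apply, ← Nat.factorization_mul Nat.card_pos.ne' Nat.card_pos.ne', hcard,
      Nat.factorization_mul Nat.card_pos.ne' Nat.card_pos.ne', Finsupp.add_apply]
  have h1 := card_inf_mul_relIndex (primesPart {p} A) (primesPart {p} B)
  have h2 := card_inf_mul_relIndex (primesPart {p} A) P
  rw [inf_eq_left.2 hAP] at h2
  rw [← h1, ← h2] at hcard'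
  refine Nat.eq_of_mul_eq_mul_left (Nat.mul_pos (Nat.card_pos (α := primesPart {p} A))
    (Nat.card_pos (α := (primesPart {p} A ⊓ primesPart {p} B : Subgroup G)))) ?_
  linarith

/-- `H * K ⊆ K * H`; for subgroups of a group this means that `H` and `K` permute. -/
def Permutes (H K : Subgroup G) : Prop :=
  ∀ h ∈ H, ∀ k ∈ K, ∃ k' ∈ K, ∃ h' ∈ H, h * k = k' * h'

theorem Permutes.exists_mul {H K : Subgroup G} (h : Permutes H K) :
    ∀ x ∈ H ⊔ K, ∃ k ∈ K, ∃ y ∈ H, x = k * y := by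
  have key : ∀ s ∈ (H ∪ K : Set G), ∀ k ∈ K, ∀ y ∈ H, ∃ k' ∈ K, ∃ y' ∈ H,
      s * (k * y) = k' * y' := by
    rintro s (hs | hs) k hk y hy
    · obtain ⟨k', hk', h', hh', e⟩ := h s hs k hk
      exact ⟨k', hk', h' * y, mul_mem hh' hy, by rw [← mul_assoc, e, mul_assoc]⟩
    · exact ⟨s * k, mul_mem hs hk, y, hy, (mul_assoc _ _ _).symm⟩
  intro x hx
  rw [sup_eq_closure] at hx
  induction hx using closure_induction_left with
  | one => exact ⟨1, one_mem _, 1, one_mem _, (mul_one 1).symm⟩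
  | mul_left s hs x _ ih =>
    obtain ⟨k, hk, y, hy, rfl⟩ := ih
    exact key s hs k hk y hy
  | inv_mul_cancel s hs x _ ih =>
    obtain ⟨k, hk, y, hy, rfl⟩ := ih
    exact key s⁻¹ (hs.imp H.inv_mem K.inv_mem) k hk y hy

theorem Permutes.sup {H₁ H₂ K : Subgroup G} (h₁ : Permutes H₁ K) (h₂ : Permutes H₂ K) :
    Permutes (H₁ ⊔ H₂) K := by
  have key : ∀ s ∈ (H₁ ∪ H₂ : Set G), ∀ k ∈ K, ∃ k' ∈ K, ∃ y ∈ H₁ ⊔ H₂, s * k = k' * y := by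
    rintro s (hs | hs) k hk
    · obtain ⟨k', hk', y, hy, e⟩ := h₁ s hs k hk
      exact ⟨k', hk', y, mem_sup_left hy, e⟩
    · obtain ⟨k', hk', y, hy, e⟩ := h₂ s hs k hk
      exact ⟨k', hk', y, mem_sup_right hy, e⟩
  have key2 : ∀ s ∈ (H₁ ∪ H₂ : Set G), ∀ x, (∀ k ∈ K, ∃ k' ∈ K, ∃ y ∈ H₁ ⊔ H₂, x * k = k' * y) →
      ∀ k ∈ K, ∃ k' ∈ K, ∃ y ∈ H₁ ⊔ H₂, s * x * k = k' * y := by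
    intro s hs x hx k hk
    obtain ⟨k', hk', y, hy, e⟩ := hx k hk
    obtain ⟨k'', hk'', y', hy', e'⟩ := key s hs k' hk'
    exact ⟨k'', hk'', y' * y, mul_mem hy' hy, by rw [mul_assoc, e, ← mul_assoc, e', mul_assoc]⟩
  intro x hx
  have hx' := hx
  rw [sup_eq_closure] at hx'
  clear hx
  induction hx' using closure_induction_left with
  | one => exact fun k hk => ⟨k, hk, 1, one_mem _, by simp⟩
  | mul_left s hs x _ ih => exact key2 s hs x ih
  | inv_mul_cancel s hs x _ ih =>
    exact key2 s⁻¹ (hs.imp H₁.inv_mem H₂.inv_mem) x ih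

theorem Permutes.map_conj {H K : Subgroup G} {g k : G}
    (h : Permutes H (K.map (MulAut.conj (k⁻¹ * g)).toMonoidHom)) :
    Permutes (H.map (MulAut.conj k).toMonoidHom) (K.map (MulAut.conj g).toMonoidHom) := by
  intro x hx y hy
  rw [mem_map_conj] at hx hy
  obtain ⟨y', hy', x', hx', e⟩ := h _ hx (k⁻¹ * y * k)
    (mem_map_conj.2 (by convert hy using 1; group))
  rw [mem_map_conj] at hy'
  refine ⟨k * y' * k⁻¹, mem_map_conj.2 (by convert hy' using 1; group),
    k * x' * k⁻¹, mem_map_conj.2 (by convert hx' using 1; group), ?_⟩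
  calc x * y = k * (k⁻¹ * x * k * (k⁻¹ * y * k)) * k⁻¹ := by group
    _ = k * y' * k⁻¹ * (k * x' * k⁻¹) := by rw [e]; group

/-- Kegel's criterion: in a simple group, two nontrivial subgroups cannot permute with all
conjugates of each other unless some such product is the whole group. -/
theorem exists_sup_map_conj_eq_top [Finite G] [IsSimpleGroup G] {H K : Subgroup G} (hH : H ≠ ⊥)
    (hK : K ≠ ⊥) (h : ∀ g : G, Permutes H (K.map (MulAut.conj g).toMonoidHom)) :
    ∃ g : G, H ⊔ K.map (MulAut.conj g).toMonoidHom = ⊤ := by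
  by_contra! hne
  obtain ⟨M, hHM, hM⟩ := (Set.toFinite {M : Subgroup G |
    (∀ g : G, Permutes M (K.map (MulAut.conj g).toMonoidHom)) ∧
      ∀ g : G, M ⊔ K.map (MulAut.conj g).toMonoidHom ≠ ⊤}).exists_le_maximal ⟨h, hne⟩
  obtain ⟨hMp, hMt⟩ := hM.prop
  have hM0 : M ≠ ⊥ := fun h0 => hH (le_bot_iff.1 (h0 ▸ hHM))
  have hM1 : M ≠ ⊤ := fun h1 => hMt 1 (by rw [h1, top_sup_eq])
  have hN : ∃ g : G, ¬ K.map (MulAut.conj g).toMonoidHom ≤ normalizer (M : Set G) := by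
    by_contra! hall
    have hle : K ≤ (normalizer (M : Set G)).normalCore := fun k hk g =>
      hall g ⟨k, hk, rfl⟩
    rcases (normalCore_normal (normalizer (M : Set G))).eq_bot_or_eq_top with h0 | h1
    · exact hK (le_bot_iff.1 (h0 ▸ hle))
    · exact normalizer_ne_top_of_ne hM0 hM1 (top_le_iff.1 (h1 ▸ normalCore_le _))
  obtain ⟨g₀, hg₀⟩ := hN
  obtain ⟨k, hk, hkM⟩ := SetLike.not_le_iff_exists.1 hg₀
  set M' := M ⊔ M.map (MulAut.conj k).toMonoidHom with hM'
  have hP : ∀ g : G, Permutes M' (K.map (MulAut.conj g).toMonoidHom) := fun g =>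
    (hMp g).sup (hMp (k⁻¹ * g)).map_conj
  have hle : M' ⊔ K.map (MulAut.conj g₀).toMonoidHom ≤ M ⊔ K.map (MulAut.conj g₀).toMonoidHom := by
    refine sup_le (sup_le le_sup_left ?_) le_sup_right
    rintro _ ⟨x, hx, rfl⟩
    exact mul_mem (mul_mem (mem_sup_right hk) (mem_sup_left hx)) (inv_mem (mem_sup_right hk))
  have hT : ∀ g : G, M' ⊔ K.map (MulAut.conj g).toMonoidHom ≠ ⊤ := by
    intro g hg
    refine hMt g₀ (top_le_iff.1 (le_trans ?_ hle))
    rw [← hg]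
    refine sup_le le_sup_left fun y hy => ?_
    obtain ⟨l, hl, x, hx, e⟩ := (hP g).exists_mul (g * g₀⁻¹) (hg ▸ mem_top _)
    have hz : x⁻¹ * y * x ∈ K.map (MulAut.conj g₀).toMonoidHom := by
      rw [mem_map_conj] at hl hy ⊢
      have h1 : x * g₀ = l⁻¹ * g := by
        rw [eq_inv_mul_iff_mul_eq, ← mul_assoc, ← e]; group
      have h2 : g₀⁻¹ * (x⁻¹ * y * x) * g₀ = (x * g₀)⁻¹ * y * (x * g₀) := by group
      have h3 : (l⁻¹ * g)⁻¹ * y * (l⁻¹ * g) =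
          g⁻¹ * l * g * (g⁻¹ * y * g) * (g⁻¹ * l * g)⁻¹ := by group
      rw [h2, h1, h3]
      exact mul_mem (mul_mem hl hy) (inv_mem hl)
    have h4 : y = x * (x⁻¹ * y * x) * x⁻¹ := by group
    rw [h4]
    exact mul_mem (mul_mem (mem_sup_left hx) (mem_sup_right hz)) (inv_mem (mem_sup_left hx))
  have hle' : M' ≤ M := hM.le_of_ge ⟨hP, hT⟩ le_sup_left
  exact hkM (mem_normalizer_of_conj_mem fun x hx => hle' (mem_sup_right ⟨x, hx, rfl⟩))

/-- A finite simple group which is the product of two nilpotent subgroups is solvable. -/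
theorem isSolvable_of_nilpotent_mul [Finite G] [IsSimpleGroup G] {A B : Subgroup G}
    (hA : Group.IsNilpotent A) (hB : Group.IsNilpotent B)
    (hAB : ∀ g : G, ∃ a ∈ A, ∃ b ∈ B, g = a * b) : Group.IsSolvable G := by
  by_contra hns
  refine hns (isSolvable_of_nilpotent_mul_of_coprime hA hB ?_ hAB)
  refine Nat.coprime_of_dvd fun p hp hpA hpB => ?_
  have := Fact.mk hp
  obtain ⟨P, hP, hAP, hBP, hmul⟩ := exists_isPGroup_eq_mul hA hB hAB hp
  have hconj : ∀ a ∈ A, ∀ x ∈ primesPart {p} A, a * x * a⁻¹ ∈ primesPart {p} A := fun a ha x hx =>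
    conj_mem_primesPart (fun y hy => mul_mem (mul_mem ha hy) (inv_mem ha)) hx
  have hmap : ∀ g : G, ∃ a ∈ A, (primesPart {p} B).map (MulAut.conj g).toMonoidHom =
      (primesPart {p} B).map (MulAut.conj a).toMonoidHom := by
    intro g
    obtain ⟨a, ha, b, hb, rfl⟩ := hAB g
    refine ⟨a, ha, ?_⟩
    refine eq_of_le_of_card_ge ?_ (by rw [card_map_conj, card_map_conj])
    rintro _ ⟨x, hx, rfl⟩
    refine ⟨b * x * b⁻¹, conj_mem_primesPart
      (fun y hy => mul_mem (mul_mem hb hy) (inv_mem hb)) hx, ?_⟩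
    simp [mul_assoc]
  obtain ⟨g, hg⟩ := exists_sup_map_conj_eq_top (primesPart_singleton_ne_bot hp hpA)
    (primesPart_singleton_ne_bot hp hpB) fun g => by
      obtain ⟨a, ha, e⟩ := hmap g
      rw [e]
      intro x hx y hy
      rw [mem_map_conj] at hy
      have hx' := hconj a⁻¹ (inv_mem ha) x hx
      rw [inv_inv] at hx'
      obtain ⟨b, hb, c, hc, h⟩ := hmul _ (mul_mem (hAP hx') (hBP hy))
      refine ⟨a * b * a⁻¹, mem_map_conj.2 (by convert hb using 1; group), a * c * a⁻¹,
        hconj a ha c hc, ?_⟩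
      calc x * y = a * (a⁻¹ * x * a * (a⁻¹ * y * a)) * a⁻¹ := by group
        _ = a * b * a⁻¹ * (a * c * a⁻¹) := by rw [h]; group
  obtain ⟨a, ha, e⟩ := hmap g
  have hle : primesPart {p} A ⊔ (primesPart {p} B).map (MulAut.conj a).toMonoidHom ≤
      P.map (MulAut.conj a).toMonoidHom := by
    refine sup_le (fun x hx => mem_map_conj.2 ?_) (map_mono hBP)
    have hx' := hconj a⁻¹ (inv_mem ha) x hx
    rw [inv_inv] at hx'
    exact hAP hx'
  rw [← e, hg] at hle
  have hS : IsPGroup p (P.map (MulAut.conj a).toMonoidHom) := hP.map _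
  have hnil := hS.isNilpotent
  refine hns (Group.isSolvable_of_surjective (f := (P.map (MulAut.conj a).toMonoidHom).subtype)
    fun s => ⟨⟨s, hle (mem_top s)⟩, rfl⟩)

end

/-- A finite nonabelian simple group admits no factorization `S = AB` with both
factors nilpotent (Wielandt–Kegel). -/
theorem no_nilpotent_factorization_of_simple {S : Type*} [Group S] [Finite S]
    (hsimple : IsSimpleGroup S) (hnonabelian : ¬ ∀ x y : S, x * y = y * x) :
    ¬ ∃ A B : Subgroup S, Group.IsNilpotent A ∧ Group.IsNilpotent B ∧
        ∀ g : S, ∃ a ∈ A, ∃ b ∈ B, g = a * b := by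
  rintro ⟨A, B, hA, hB, hAB⟩
  exact hnonabelian (IsSimpleGroup.comm_iff_isSolvable.2 (isSolvable_of_nilpotent_mul hA hB hAB))
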